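/- There exists an absolute constant c > 0 such that for every d ≥ 1 there exists t ∈ ℕ with the following property: for every finite nonempty A ⊆ ℤ with 2^{d−1}·#A ≤ #(A+A) < 2^d·#A and every natural number d' < d, if A is (d,t)-non-degenerate then there exist a set X ⊆ ℤ with #X ≤ d·exp(exp(c·d')) and a d-GAP P ⊆ ℤ with #P ≤ t·#A such that A ⊆ X+P. -/

import Mathlib

open Set Pointwise

/-- `P` is a `d`-dimensional generalized arithmetic progression in `ℤ`:
`P = {∑ i, λ i * a i : 1 ≤ λ i ≤ ℓ i}`. -/
def IsGAP (d : ℕ) (P : Set ℤ) : Prop :=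
  ∃ (a : Fin d → ℤ) (l : Fin d → ℕ), (∀ i, 1 ≤ l i) ∧
    P = {x | ∃ lam : Fin d → ℕ, (∀ i, 1 ≤ lam i ∧ lam i ≤ l i) ∧ x = ∑ i, (lam i : ℤ) * a i}

/-- `A ⊆ ℤ` is `(d,t)`-non-degenerate: there are no finite `X` with `#X ≤ t` and
`(d-1)`-GAP `P` with `A ⊆ X + P` and `#(X+P) ≤ t·#A`. -/
def NonDegenerate (d t : ℕ) (A : Set ℤ) : Prop :=
  ¬ ∃ X P : Set ℤ, X.Finite ∧ X.ncard ≤ t ∧ IsGAP (d - 1) P ∧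
      A ⊆ X + P ∧ (X + P).ncard ≤ t * A.ncard

/-- A norm on a lattice: an even, homogeneous, subadditive, positive function with finite balls. -/
structure IsLatticeNorm {L : Type*} [AddCommGroup L] (N : L → ℝ) : Prop where
  pos : ∀ x, x ≠ 0 → 0 < N x
  zsmul : ∀ (n : ℤ) x, N (n • x) = |(n : ℝ)| * N x
  add_le : ∀ x y, N (x + y) ≤ N x + N y
  finite : ∀ R : ℝ, {x | N x ≤ R}.Finite

namespace IsLatticeNorm

variable {L : Type*} [AddCommGroup L] {N : L → ℝ}

lemma map_zero (h : IsLatticeNorm N) : N 0 = 0 := by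
  simpa using h.zsmul 0 0

lemma nonneg (h : IsLatticeNorm N) (x : L) : 0 ≤ N x := by
  rcases eq_or_ne x 0 with rfl | hx
  · exact h.map_zero.ge
  · exact (h.pos x hx).le

lemma sum_le (h : IsLatticeNorm N) {ι : Type*} (s : Finset ι) (f : ι → L) :
    N (∑ i ∈ s, f i) ≤ ∑ i ∈ s, N (f i) :=
  Finset.le_sum_of_subadditive N h.map_zero.le h.add_le s f

lemma comap (h : IsLatticeNorm N) {L' : Type*} [AddCommGroup L'] (f : L' →+ L)
    (hf : Function.Injective f) : IsLatticeNorm (fun x => N (f x)) where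
  pos x hx := h.pos _ ((map_ne_zero_iff f hf).2 hx)
  zsmul n x := by rw [map_zsmul, h.zsmul]
  add_le x y := by rw [map_add]; exact h.add_le _ _
  finite R := (h.finite R).preimage hf.injOn

/-- Among the nonzero vectors with a given property there is one of least norm. -/
lemma exists_minimal (h : IsLatticeNorm N) (p : L → Prop) {y : L} (hy : y ≠ 0) (hpy : p y) :
    ∃ u, u ≠ 0 ∧ p u ∧ ∀ x, x ≠ 0 → p x → N u ≤ N x := by
  have hfin : {x | x ≠ 0 ∧ p x ∧ N x ≤ N y}.Finite :=
    (h.finite (N y)).subset fun x hx => hx.2.2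
  obtain ⟨u, hu, hmin⟩ := exists_min_image _ N hfin ⟨y, hy, hpy, le_rfl⟩
  refine ⟨u, hu.1, hu.2.1, fun x hx hpx => ?_⟩
  rcases le_total (N x) (N y) with hxy | hxy
  · exact hmin x ⟨hx, hpx, hxy⟩
  · exact hu.2.2.trans hxy

lemma exists_int_near (n j : ℤ) (hn : n ≠ 0) : ∃ q : ℤ, 2 * |(j - q * n : ℤ)| ≤ |n| := by
  refine ⟨round ((j : ℚ) / n), ?_⟩
  have h := abs_sub_round ((j : ℚ) / n)
  have hn' : (0 : ℚ) < |(n : ℚ)| := by positivity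
  have : |(j : ℚ) - round ((j : ℚ) / n) * n| ≤ 1 / 2 * |(n : ℚ)| := by
    calc |(j : ℚ) - round ((j : ℚ) / n) * n|
        = |(j : ℚ) / n - round ((j : ℚ) / n)| * |(n : ℚ)| := by
          rw [← abs_mul]; congr 1; field_simp
      _ ≤ _ := by gcongr
  have h2 : 2 * |((j - round ((j : ℚ) / n) * n : ℤ) : ℚ)| ≤ |(n : ℚ)| := by
    push_cast; linarith
  exact_mod_cast h2

lemma mem_zmultiples_of_minimal (h : IsLatticeNorm N) {K : AddSubgroup L}
    (hK : ∀ (n : ℤ) x, n ≠ 0 → n • x ∈ K → x ∈ K) {u : L} (hu0 : u ≠ 0) (hu : u ∈ K)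
    (hmin : ∀ x, x ≠ 0 → x ∈ K → N u ≤ N x) (n : ℤ) (x : L) (hn : n ≠ 0)
    (hx : n • x ∈ Submodule.span ℤ {u}) : x ∈ Submodule.span ℤ {u} := by
  obtain ⟨j, hj⟩ := Submodule.mem_span_singleton.1 hx
  obtain ⟨q, hq⟩ := exists_int_near n j hn
  have hxK : x ∈ K := hK n x hn (hj ▸ K.zsmul_mem hu j)
  have hmul : n • (x - q • u) = (j - q * n) • u := by
    rw [smul_sub, ← hj, sub_smul, smul_smul, mul_comm]
  have hnorm := congrArg N hmul
  rw [h.zsmul, h.zsmul] at hnorm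
  have hupos := h.pos u hu0
  have hq' : 2 * |((j - q * n : ℤ) : ℝ)| ≤ |(n : ℝ)| := by exact_mod_cast hq
  have hnpos : (0 : ℝ) < |(n : ℝ)| := by positivity
  have hlt : N (x - q • u) < N u := by
    by_contra! hcon
    nlinarith [mul_le_mul_of_nonneg_left hcon hnpos.le]
  have hzero : x - q • u = 0 := by
    by_contra hne
    exact (hmin _ hne (K.sub_mem hxK (K.zsmul_mem hu q))).not_gt hlt
  exact Submodule.mem_span_singleton.2 ⟨q, (sub_eq_zero.1 hzero).symm⟩

end IsLatticeNorm

/-- The norm induced on the quotient of a lattice by the line through `u`. -/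
noncomputable def quotientNorm {L : Type*} [AddCommGroup L] (N : L → ℝ) (u : L)
    (q : L ⧸ Submodule.span ℤ {u}) : ℝ :=
  sInf {r | ∃ (x : L) (m : ℕ), 0 < m ∧ Submodule.Quotient.mk x = (m : ℤ) • q ∧ r = N x / m}

namespace IsLatticeNorm

variable {L : Type*} [AddCommGroup L] {N : L → ℝ}

lemma quotientNorm_le (h : IsLatticeNorm N) {u x : L} {m : ℕ} (hm : 0 < m)
    {q : L ⧸ Submodule.span ℤ {u}} (hx : Submodule.Quotient.mk x = (m : ℤ) • q) :
    quotientNorm N u q ≤ N x / m := by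
  refine csInf_le ⟨0, ?_⟩ ⟨x, m, hm, hx, rfl⟩
  rintro _ ⟨y, n, -, -, rfl⟩
  exact div_nonneg (h.nonneg y) n.cast_nonneg

lemma quotientNorm_mk_le (h : IsLatticeNorm N) (u x : L) :
    quotientNorm N u (Submodule.Quotient.mk x) ≤ N x := by
  simpa using h.quotientNorm_le (u := u) (x := x) one_pos (by simp)

lemma exists_lt_of_quotientNorm_lt {u : L} {q : L ⧸ Submodule.span ℤ {u}} {r : ℝ}
    (hr : quotientNorm N u q < r) :
    ∃ (x : L) (m : ℕ), 0 < m ∧ Submodule.Quotient.mk x = (m : ℤ) • q ∧ N x / m < r := by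
  obtain ⟨y, hy⟩ := Submodule.Quotient.mk_surjective _ q
  obtain ⟨_, ⟨x, m, hm, hx, rfl⟩, hlt⟩ := exists_lt_of_csInf_lt
    (⟨N y / (1 : ℕ), y, 1, one_pos, by simpa using hy, rfl⟩ : Set.Nonempty
      {r | ∃ (x : L) (m : ℕ), 0 < m ∧ Submodule.Quotient.mk x = (m : ℤ) • q ∧ r = N x / m}) hr
  exact ⟨x, m, hm, hx, hlt⟩

lemma exists_lift (h : IsLatticeNorm N) {u : L} (hu : u ≠ 0) (q : L ⧸ Submodule.span ℤ {u}) :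
    ∃ x, Submodule.Quotient.mk x = q ∧ N x ≤ quotientNorm N u q + 3 / 4 * N u := by
  have hupos := h.pos u hu
  obtain ⟨x, m, hm, hx, hlt⟩ := exists_lt_of_quotientNorm_lt
    (show quotientNorm N u q < quotientNorm N u q + 1 / 4 * N u by linarith)
  obtain ⟨y, rfl⟩ := Submodule.Quotient.mk_surjective _ q
  have hmem : (m : ℤ) • y - x ∈ Submodule.span ℤ {u} := by
    rw [← Submodule.Quotient.mk_eq_zero, Submodule.Quotient.mk_sub, hx]
    simp
  obtain ⟨j, hj⟩ := Submodule.mem_span_singleton.1 hmem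
  obtain ⟨k, hk⟩ := exists_int_near m j (by positivity)
  refine ⟨y - k • u, ?_, ?_⟩
  · rw [Submodule.Quotient.eq]
    exact Submodule.mem_span_singleton.2 ⟨-k, by rw [neg_smul]; abel⟩
  have hm' : (0 : ℝ) < m := by exact_mod_cast hm
  have e : (m : ℤ) • (y - k • u) = x + (j - k * m) • u := by
    rw [sub_smul, hj, smul_sub, smul_smul, mul_comm (m : ℤ) k]; abel
  have e2 := congrArg N e
  rw [h.zsmul] at e2
  have e3 := h.add_le x ((j - k * m) • u)
  rw [h.zsmul, ← e2] at e3
  have hk' : 2 * |((j - k * m : ℤ) : ℝ)| ≤ m := by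
    have : 2 * |((j - k * m : ℤ) : ℝ)| ≤ |((m : ℤ) : ℝ)| := by exact_mod_cast hk
    simpa using this
  rw [div_lt_iff₀ hm'] at hlt
  have habs : |((m : ℤ) : ℝ)| = m := by simp
  rw [habs] at e3
  refine le_of_mul_le_mul_left ?_ hm'
  nlinarith [mul_le_mul_of_nonneg_right hk' hupos.le]

/-- The quotient norm is a lattice norm if the quotient has no torsion. -/
lemma quotient (h : IsLatticeNorm N) {u : L} (hu : u ≠ 0)
    (htf : ∀ (n : ℤ) x, n ≠ 0 → n • x ∈ Submodule.span ℤ {u} → x ∈ Submodule.span ℤ {u}) :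
    IsLatticeNorm (quotientNorm N u) := by
  have hnonneg : ∀ q, 0 ≤ quotientNorm N u q := fun q =>
    Real.sInf_nonneg (by rintro _ ⟨y, n, -, -, rfl⟩; exact div_nonneg (h.nonneg y) n.cast_nonneg)
  have hfin : ∀ R : ℝ, {q | quotientNorm N u q ≤ R}.Finite := fun R => by
    refine ((h.finite (R + 3 / 4 * N u)).image Submodule.Quotient.mk).subset fun q hq => ?_
    obtain ⟨x, hx, hle⟩ := h.exists_lift hu q
    exact ⟨x, hle.trans (by gcongr; exact hq), hx⟩
  have hsmul : ∀ (n : ℤ) q, quotientNorm N u (n • q) = |(n : ℝ)| * quotientNorm N u q := by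
    intro n q
    rcases eq_or_ne n 0 with rfl | hn
    · refine le_antisymm ?_ (by simpa using hnonneg _)
      simpa [h.map_zero] using h.quotientNorm_mk_le u 0
    have hn' : (0 : ℝ) < |(n : ℝ)| := by positivity
    apply le_antisymm
    · rw [mul_comm, ← div_le_iff₀ hn']
      refine le_of_forall_gt fun r hr => ?_
      obtain ⟨x, m, hm, hx, hlt⟩ := exists_lt_of_quotientNorm_lt hr
      have hm' : (0 : ℝ) < m := by exact_mod_cast hm
      rw [div_lt_iff₀ hn']
      refine (h.quotientNorm_le (x := n • x) hm ?_).trans_lt ?_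
      · rw [Submodule.Quotient.mk_smul, hx, smul_comm]
      · rw [h.zsmul, mul_div_assoc, mul_comm]; gcongr
    · refine le_of_forall_gt fun r hr => ?_
      obtain ⟨x, m, hm, hx, hlt⟩ := exists_lt_of_quotientNorm_lt hr
      have hm' : (0 : ℝ) < m := by exact_mod_cast hm
      have := h.quotientNorm_le (u := u) (q := q) (x := n.sign • x) (m := m * n.natAbs)
        (by positivity) (by
          rw [Submodule.Quotient.mk_smul, hx, smul_smul, smul_smul]
          congr 1
          rw [Nat.cast_mul, Int.natCast_natAbs, mul_right_comm, Int.sign_mul_self_eq_abs, mul_comm])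
      have hs : |((n.sign : ℤ) : ℝ)| = 1 := by
        rw [← Int.cast_abs, Int.abs_sign_of_ne_zero hn]; simp
      rw [h.zsmul, hs, one_mul, Nat.cast_mul, Nat.cast_natAbs, Int.cast_abs] at this
      calc |(n : ℝ)| * quotientNorm N u q ≤ |(n : ℝ)| * (N x / (m * |(n : ℝ)|)) := by gcongr
        _ = N x / m := by field_simp
        _ < r := hlt
  refine ⟨fun q hq => (hnonneg q).lt_of_ne fun h0 => ?_, hsmul, fun q q' => ?_, hfin⟩
  · have hinj : Function.Injective fun n : ℤ => n • q := by
      intro n n' hnn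
      by_contra hne
      obtain ⟨y, rfl⟩ := Submodule.Quotient.mk_surjective _ q
      refine hq ((Submodule.Quotient.mk_eq_zero _).2 (htf (n - n') y (sub_ne_zero.2 hne) ?_))
      rw [← Submodule.Quotient.mk_eq_zero, Submodule.Quotient.mk_smul, sub_smul, sub_eq_zero]
      exact hnn
    refine Set.infinite_range_of_injective hinj ((hfin 0).subset ?_)
    rintro _ ⟨n, rfl⟩
    simp [hsmul, ← h0]
  · refine le_of_forall_pos_lt_add fun ε hε => ?_
    obtain ⟨x, m, hm, hx, hlt⟩ := exists_lt_of_quotientNorm_lt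
      (show quotientNorm N u q < quotientNorm N u q + ε / 2 by linarith)
    obtain ⟨x', m', hm', hx', hlt'⟩ := exists_lt_of_quotientNorm_lt
      (show quotientNorm N u q' < quotientNorm N u q' + ε / 2 by linarith)
    have hmr : (0 : ℝ) < m := by exact_mod_cast hm
    have hmr' : (0 : ℝ) < m' := by exact_mod_cast hm'
    have := h.quotientNorm_le (u := u) (q := q + q') (x := (m' : ℤ) • x + (m : ℤ) • x')
      (m := m * m') (by positivity) (by
        rw [Submodule.Quotient.mk_add, Submodule.Quotient.mk_smul, Submodule.Quotient.mk_smul, hx,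
          hx', smul_smul, smul_smul, smul_add]
        push_cast
        rw [mul_comm (m' : ℤ)])
    have h2 := h.add_le ((m' : ℤ) • x) ((m : ℤ) • x')
    rw [h.zsmul, h.zsmul] at h2
    simp only [Int.cast_natCast, Nat.abs_cast] at h2
    have h3 : N ((m' : ℤ) • x + (m : ℤ) • x') / ((m * m' : ℕ) : ℝ) ≤ N x / m + N x' / m' := by
      rw [Nat.cast_mul, div_le_iff₀ (by positivity)]
      refine h2.trans (le_of_eq ?_)
      field_simp
    linarith

end IsLatticeNorm

lemma free_quotient_span_singleton {L : Type*} [AddCommGroup L] [Module.Finite ℤ L] {u : L}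
    (htf : ∀ (n : ℤ) x, n ≠ 0 → n • x ∈ Submodule.span ℤ {u} → x ∈ Submodule.span ℤ {u}) :
    Module.Free ℤ (L ⧸ Submodule.span ℤ {u}) := by
  have : Module.IsTorsionFree ℤ (L ⧸ Submodule.span ℤ {u}) := by
    refine ⟨fun n hn q q' hqq => ?_⟩
    obtain ⟨x, rfl⟩ := Submodule.Quotient.mk_surjective _ q
    obtain ⟨y, rfl⟩ := Submodule.Quotient.mk_surjective _ q'
    rw [Submodule.Quotient.eq]
    refine htf n _ hn.ne_zero ?_
    rw [smul_sub, ← Submodule.Quotient.eq]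
    simpa using hqq
  exact Module.free_of_finite_type_torsion_free'

lemma finrank_quotient_span_singleton {L : Type*} [AddCommGroup L] [Module.Free ℤ L]
    [Module.Finite ℤ L] {u : L} (hu : u ≠ 0) :
    Module.finrank ℤ (L ⧸ Submodule.span ℤ {u}) + 1 = Module.finrank ℤ L := by
  have h1 := Submodule.finrank_quotient_add_finrank (Submodule.span ℤ {u})
  have h2 := (LinearEquiv.toSpanNonzeroSingleton ℤ L u hu).finrank_eq
  rw [Module.finrank_self] at h2
  omega

/-- The constant in the reduced basis theorem. -/
def reducedConst : ℕ → ℕ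
  | 0 => 1
  | k + 1 => 1 + 4 * (k + 1) * reducedConst k

lemma reducedConst_mono : Monotone reducedConst :=
  monotone_nat_of_le_succ fun k => by simp only [reducedConst]; nlinarith [Nat.zero_le (reducedConst k)]

/-- Every lattice norm admits a reduced basis. -/
theorem IsLatticeNorm.exists_reduced_basis (k : ℕ) :
    ∀ {L : Type} [AddCommGroup L] [Module.Free ℤ L] [Module.Finite ℤ L] {N : L → ℝ},
      IsLatticeNorm N → Module.finrank ℤ L = k →
      ∃ b : Fin k → L, (∀ n : Fin k → ℤ, ∑ i, n i • b i = 0 → n = 0) ∧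
        ∀ x, ∃ n : Fin k → ℤ, x = ∑ i, n i • b i ∧
          ∀ i, |(n i : ℝ)| * N (b i) ≤ reducedConst k * N x := by
  induction k with
  | zero =>
    intro L _ _ _ N h hk
    have : Subsingleton L := Module.finrank_zero_iff.1 hk
    exact ⟨Fin.elim0, fun n _ => Subsingleton.elim _ _, fun x =>
      ⟨Fin.elim0, Subsingleton.elim _ _, fun i => i.elim0⟩⟩
  | succ k ih =>
    intro L _ _ _ N h hk
    have : Nontrivial L := Module.nontrivial_of_finrank_pos (R := ℤ) (by omega)
    obtain ⟨y, hy⟩ := exists_ne (0 : L)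
    obtain ⟨u, hu0, -, hmin⟩ := h.exists_minimal (fun _ => True) hy trivial
    have hmin' : ∀ x, x ≠ 0 → N u ≤ N x := fun x hx => hmin x hx trivial
    have htf : ∀ (n : ℤ) x, n ≠ 0 → n • x ∈ Submodule.span ℤ {u} → x ∈ Submodule.span ℤ {u} :=
      h.mem_zmultiples_of_minimal (K := ⊤) (fun _ _ _ _ => AddSubgroup.mem_top _) hu0
        (AddSubgroup.mem_top _) fun x hx _ => hmin' x hx
    have hq := h.quotient hu0 htf
    have : Module.Free ℤ (L ⧸ Submodule.span ℤ {u}) := free_quotient_span_singleton htf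
    have hrank : Module.finrank ℤ (L ⧸ Submodule.span ℤ {u}) = k := by
      have := finrank_quotient_span_singleton hu0
      omega
    obtain ⟨b, hli, hspan⟩ := ih hq hrank
    choose c hc hcN using fun i => h.exists_lift hu0 (b i)
    have hb0 : ∀ i, b i ≠ 0 := fun i hi => by
      have := congrFun (hli (Pi.single i 1) (by simp [Pi.single_apply, hi])) i
      simp at this
    have hc0 : ∀ i, c i ≠ 0 := fun i hi => hb0 i (by rw [← hc i, hi]; simp)
    have hc4 : ∀ i, N (c i) ≤ 4 * quotientNorm N u (b i) := fun i => by
      linarith [hcN i, hmin' _ (hc0 i)]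
    have hsum : ∀ n : Fin k → ℤ, (Submodule.Quotient.mk (∑ i, n i • c i) :
        L ⧸ Submodule.span ℤ {u}) = ∑ i, n i • b i := fun n => by
      rw [← Submodule.mkQ_apply, map_sum]
      simp [hc]
    refine ⟨Fin.cons u c, fun n hn => ?_, fun x => ?_⟩
    · simp only [Fin.sum_univ_succ, Fin.cons_zero, Fin.cons_succ] at hn
      have h1 : ∑ i, n (Fin.succ i) • b i = 0 := by
        rw [← hsum, Submodule.Quotient.mk_eq_zero, eq_neg_of_add_eq_zero_right hn]
        exact Submodule.neg_mem _ (Submodule.smul_mem _ _ (Submodule.mem_span_singleton_self u))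
      have h2 := hli _ h1
      have h3 : ∀ i, n (Fin.succ i) = 0 := fun i => congrFun h2 i
      simp only [h3, zero_smul, Finset.sum_const_zero, add_zero] at hn
      have h4 := congrArg N hn
      rw [h.zsmul, h.map_zero] at h4
      have h5 : n 0 = 0 := by
        have := (mul_eq_zero.1 h4).resolve_right (h.pos u hu0).ne'
        simpa using this
      funext i
      exact Fin.cases h5 h3 i
    · obtain ⟨n, hn, hnb⟩ := hspan (Submodule.Quotient.mk x)
      have hmem : x - ∑ i, n i • c i ∈ Submodule.span ℤ {u} := by
        rw [← Submodule.Quotient.mk_eq_zero, Submodule.Quotient.mk_sub, hsum, ← hn, sub_self]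
      obtain ⟨j, hj⟩ := Submodule.mem_span_singleton.1 hmem
      have hC : (0 : ℝ) ≤ reducedConst k := Nat.cast_nonneg _
      have hx0 := h.nonneg x
      have hbound : ∀ i, |(n i : ℝ)| * N (c i) ≤ 4 * reducedConst k * N x := fun i => by
        calc |(n i : ℝ)| * N (c i) ≤ |(n i : ℝ)| * (4 * quotientNorm N u (b i)) := by
              gcongr; exact hc4 i
          _ = 4 * (|(n i : ℝ)| * quotientNorm N u (b i)) := by ring
          _ ≤ 4 * (reducedConst k * N x) := by
              refine mul_le_mul_of_nonneg_left ((hnb i).trans ?_) (by norm_num)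
              gcongr
              exact h.quotientNorm_mk_le u x
          _ = _ := by ring
      refine ⟨Fin.cons j n, ?_, fun i => ?_⟩
      · simp only [Fin.sum_univ_succ, Fin.cons_zero, Fin.cons_succ, hj]
        abel
      · simp only [reducedConst]
        push_cast
        refine Fin.cases ?_ (fun i => ?_) i
        · simp only [Fin.cons_zero]
          rw [← h.zsmul, hj, sub_eq_add_neg]
          have h1 := h.add_le x (-∑ i, n i • c i)
          have h2 : N (-∑ i, n i • c i) ≤ ∑ i, |(n i : ℝ)| * N (c i) := by
            rw [← Finset.sum_neg_distrib]
            refine (h.sum_le _ _).trans (Finset.sum_le_sum fun i _ => ?_)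
            rw [← neg_smul, h.zsmul]; simp
          have h3 : ∑ i, |(n i : ℝ)| * N (c i) ≤ k * (4 * reducedConst k * N x) := by
            refine (Finset.sum_le_sum fun i _ => hbound i).trans (le_of_eq ?_)
            simp
          nlinarith [mul_nonneg hC hx0]
        · simp only [Fin.cons_succ]
          refine (hbound i).trans ?_
          have : 0 ≤ (k : ℝ) * (reducedConst k * N x) := by positivity
          nlinarith [mul_nonneg hC hx0]

/-- The integer box with half side lengths `l`. -/
noncomputable def intBox {ι : Type*} [Fintype ι] [DecidableEq ι] (l : ι → ℕ) : Finset (ι → ℤ) :=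
  Finset.Icc (fun i => -(l i : ℤ)) (fun i => l i)

section intBox

variable {ι : Type*} [Fintype ι] [DecidableEq ι] {l : ι → ℕ}

lemma mem_intBox {z : ι → ℤ} : z ∈ intBox l ↔ ∀ i, |z i| ≤ l i := by
  simp only [intBox, Finset.mem_Icc, Pi.le_def, abs_le, forall_and]

lemma card_intBox (l : ι → ℕ) : (intBox l).card = ∏ i, (2 * l i + 1) := by
  rw [intBox, Pi.card_Icc]
  refine Finset.prod_congr rfl fun i _ => ?_
  rw [Int.card_Icc]
  omega

lemma zero_mem_intBox (l : ι → ℕ) : (0 : ι → ℤ) ∈ intBox l := by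
  simp [mem_intBox]

end intBox

/-- The sup norm with weights `w`. -/
noncomputable def weightedNorm {ι : Type*} [Fintype ι] (w : ι → ℝ) (z : ι → ℤ) : ℝ :=
  ‖fun i => (z i : ℝ) / w i‖

section weightedNorm

variable {ι : Type*} [Fintype ι] {w : ι → ℝ}

lemma weightedNorm_le_iff (hw : ∀ i, 0 < w i) {z : ι → ℤ} {R : ℝ} (hR : 0 ≤ R) :
    weightedNorm w z ≤ R ↔ ∀ i, |(z i : ℝ)| ≤ R * w i := by
  rw [weightedNorm, pi_norm_le_iff_of_nonneg hR]
  refine forall_congr' fun i => ?_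
  rw [Real.norm_eq_abs, abs_div, abs_of_pos (hw i), div_le_iff₀ (hw i)]

lemma isLatticeNorm_weightedNorm (hw : ∀ i, 0 < w i) : IsLatticeNorm (weightedNorm w) where
  pos z hz := by
    rw [weightedNorm, norm_pos_iff]
    intro h0
    refine hz (funext fun i => ?_)
    have := congrFun h0 i
    simpa [(hw i).ne'] using this
  zsmul n z := by
    rw [weightedNorm, weightedNorm, ← Real.norm_eq_abs, ← norm_smul]
    congr 1
    funext i
    simp [mul_div_assoc]
  add_le x y := by
    refine le_trans (le_of_eq ?_) (norm_add_le _ _)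
    rw [weightedNorm]
    congr 1
    funext i
    simp [add_div]
  finite R := by
    classical
    refine (Finset.finite_toSet (intBox fun i => ⌊|R| * w i⌋₊)).subset fun z hz => ?_
    rw [Finset.mem_coe, mem_intBox]
    intro i
    have h1 := (weightedNorm_le_iff hw (abs_nonneg R)).1 (le_trans hz (le_abs_self R)) i
    have h2 : ((z i).natAbs : ℝ) ≤ |R| * w i := by
      rwa [Nat.cast_natAbs, Int.cast_abs]
    have h3 := Nat.le_floor h2
    rw [← Int.natCast_natAbs]
    exact_mod_cast h3

end weightedNorm

/-- The coefficient vectors of the points of norm at most `R` in a reduced basis lie in a box. -/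
lemma mem_intBox_of_mul_le {k : ℕ} {n : Fin k → ℤ} {w : Fin k → ℝ} {R : ℝ} (hw : ∀ i, 0 < w i)
    (h : ∀ i, |(n i : ℝ)| * w i ≤ R) : n ∈ intBox fun i => ⌊R / w i⌋₊ := by
  rw [mem_intBox]
  intro i
  have h2 : ((n i).natAbs : ℝ) ≤ R / w i := by
    rw [Nat.cast_natAbs, Int.cast_abs, le_div_iff₀ (hw i)]
    exact h i
  have h3 := Nat.le_floor h2
  rw [← Int.natCast_natAbs]
  exact_mod_cast h3

lemma abs_mul_le_of_mem_intBox {k : ℕ} {n : Fin k → ℤ} {w : Fin k → ℝ} {R : ℝ} (hR : 0 ≤ R)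
    (hw : ∀ i, 0 < w i) (h : n ∈ intBox fun i => ⌊R / w i⌋₊) (i : Fin k) :
    |(n i : ℝ)| * w i ≤ R := by
  rw [← le_div_iff₀ (hw i)]
  have h1 := mem_intBox.1 h i
  have h2 : |(n i : ℝ)| ≤ (⌊R / w i⌋₊ : ℝ) := by exact_mod_cast h1
  exact h2.trans (Nat.floor_le (div_nonneg hR (hw i).le))

/-- If a generalized arithmetic progression is not proper, it is contained in one of smaller
dimension and comparable size. -/
theorem exists_rank_reduction (D M : ℕ) : ∃ C : ℕ, ∀ (φ : (Fin (D + 1) → ℤ) →+ ℤ)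
    (l : Fin (D + 1) → ℕ) (v : Fin (D + 1) → ℤ), v ≠ 0 → (∀ i, |v i| ≤ M * (l i + 1)) → φ v = 0 →
    ∃ (φ' : (Fin D → ℤ) →+ ℤ) (l' : Fin D → ℕ),
      (∀ z ∈ intBox l, ∃ z' ∈ intBox l', φ z = φ' z') ∧
      ∏ i, (2 * l' i + 1) ≤ C * ∏ i, (2 * l i + 1) := by
  set Q : ℕ := D * reducedConst D + M with hQ
  refine ⟨(2 * Q + 1) ^ (D + 1), fun φ l v hv hvl hφv => ?_⟩
  set w : Fin (D + 1) → ℝ := fun i => l i + 1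
  have hw : ∀ i, 0 < w i := fun i => by positivity
  have hN := isLatticeNorm_weightedNorm hw
  obtain ⟨u, hu0, hu, hmin⟩ := hN.exists_minimal (· ∈ φ.ker) hv hφv
  have hφu : φ u = 0 := hu
  have huM : weightedNorm w u ≤ M := (hmin v hv hφv).trans <|
    (weightedNorm_le_iff hw (Nat.cast_nonneg M)).2 fun i => by
      simp only [w]
      exact_mod_cast hvl i
  have htf := hN.mem_zmultiples_of_minimal (K := φ.ker) (fun n x hn hx => by
    have : n * φ x = 0 := by
      rw [← smul_eq_mul, ← map_zsmul]
      exact hx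
    exact (mul_eq_zero.1 this).resolve_left hn) hu0 hu hmin
  have hq := hN.quotient hu0 htf
  have : Module.Free ℤ ((Fin (D + 1) → ℤ) ⧸ Submodule.span ℤ {u}) :=
    free_quotient_span_singleton htf
  have hrank : Module.finrank ℤ ((Fin (D + 1) → ℤ) ⧸ Submodule.span ℤ {u}) = D := by
    have := finrank_quotient_span_singleton hu0
    rw [Module.finrank_fin_fun] at this
    omega
  obtain ⟨b, hli, hspan⟩ := IsLatticeNorm.exists_reduced_basis D hq hrank
  have hb0 : ∀ i, 0 < quotientNorm (weightedNorm w) u (b i) := fun i => hq.pos _ fun hi => by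
    have := congrFun (hli (Pi.single i 1) (by simp [Pi.single_apply, hi])) i
    simp at this
  set ψ : ((Fin (D + 1) → ℤ) ⧸ Submodule.span ℤ {u}) →ₗ[ℤ] ℤ :=
    Submodule.liftQ _ φ.toIntLinearMap (by
      rw [Submodule.span_singleton_le_iff_mem]
      exact hφu) with hψ
  set l' : Fin D → ℕ := fun i => ⌊(reducedConst D : ℝ) / quotientNorm (weightedNorm w) u (b i)⌋₊
  refine ⟨(∑ i, (LinearMap.proj i : (Fin D → ℤ) →ₗ[ℤ] ℤ).smulRight (ψ (b i))).toAddMonoidHom,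
    l', fun z hz => ?_, ?_⟩
  · obtain ⟨n, hn, hnb⟩ := hspan (Submodule.Quotient.mk z)
    have hz1 : weightedNorm w z ≤ 1 := (weightedNorm_le_iff hw zero_le_one).2 fun i => by
      have : |(z i : ℝ)| ≤ l i := by exact_mod_cast mem_intBox.1 hz i
      simp only [w]
      linarith
    refine ⟨n, mem_intBox_of_mul_le hb0 fun i => (hnb i).trans ?_, ?_⟩
    · have := (hN.quotientNorm_mk_le u z).trans hz1
      exact mul_le_of_le_one_right (Nat.cast_nonneg _) this
    · have h1 : ψ (Submodule.Quotient.mk z) = φ z := rfl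
      rw [← h1, hn, map_sum]
      simp
  · rw [← card_intBox, ← card_intBox]
    choose c hc hcN using fun q => hN.exists_lift hu0 q
    have hcard : (intBox l').card ≤ (intBox fun i => Q * (l i + 1)).card := by
      refine Finset.card_le_card_of_injOn (fun n => c (∑ i, n i • b i)) (fun n hn => ?_)
        fun n _ n' _ hnn => ?_
      · have h1 : quotientNorm (weightedNorm w) u (∑ i, n i • b i) ≤ D * reducedConst D := by
          refine (hq.sum_le _ _).trans ?_
          calc ∑ i, quotientNorm (weightedNorm w) u (n i • b i)
              ≤ ∑ _i : Fin D, (reducedConst D : ℝ) := Finset.sum_le_sum fun i _ => by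
                rw [hq.zsmul]
                exact abs_mul_le_of_mem_intBox (Nat.cast_nonneg _) hb0 hn i
            _ = _ := by simp
        have h2 := hcN (∑ i, n i • b i)
        have h3 : weightedNorm w (c (∑ i, n i • b i)) ≤ Q := by
          rw [hQ]
          push_cast
          linarith [hN.nonneg u]
        rw [Finset.mem_coe, mem_intBox]
        intro i
        have := (weightedNorm_le_iff hw (Nat.cast_nonneg Q)).1 h3 i
        simp only [w] at this
        exact_mod_cast this
      · have h1 : ∑ i, n i • b i = ∑ i, n' i • b i := by
          rw [← hc (∑ i, n i • b i), ← hc (∑ i, n' i • b i)]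
          exact congrArg _ hnn
        refine sub_eq_zero.1 (hli (n - n') ?_)
        simp [sub_smul, h1]
    refine hcard.trans ?_
    have hpow : (2 * Q + 1) ^ (D + 1) = ∏ _i : Fin (D + 1), (2 * Q + 1) := by simp
    rw [card_intBox, card_intBox, hpow, ← Finset.prod_mul_distrib]
    refine Finset.prod_le_prod' fun i _ => ?_
    nlinarith [Nat.zero_le (Q * l i), Nat.zero_le (l i)]

lemma integral_indicator_le_eq {c : ℝ} (hc : 0 ≤ c) :
    ∫ s in (0 : ℝ)..1, {s | s ≤ c}.indicator (fun _ => (1 : ℝ)) s = min c 1 := by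
  rcases le_total c 1 with h | h
  · rw [intervalIntegral.integral_indicator ⟨hc, h⟩]
    simp [h]
  · rw [intervalIntegral.integral_congr (g := fun _ => 1)]
    · simp [h]
    · intro s hs
      rw [uIcc_of_le zero_le_one] at hs
      simp [hs.2.trans h]

lemma intervalIntegrable_indicator_le (c : ℝ) : IntervalIntegrable
    ({s | s ≤ c}.indicator fun _ => (1 : ℝ)) MeasureTheory.volume 0 1 := by
  refine Antitone.intervalIntegrable fun s t hst => ?_
  by_cases ht : t ≤ c
  · simp [ht, hst.trans ht]
  · simpa [ht] using indicator_nonneg (fun _ _ => zero_le_one) s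

lemma integral_card_filter_le (I : Finset ℤ) (f : ℤ → ℝ) (hf : ∀ x ∈ I, 0 ≤ f x) :
    IntervalIntegrable (fun s : ℝ => ((I.filter fun x => s ≤ f x).card : ℝ))
      MeasureTheory.volume 0 1 ∧
    ∫ s in (0 : ℝ)..1, ((I.filter fun x => s ≤ f x).card : ℝ) = ∑ x ∈ I, min (f x) 1 := by
  have h : (fun s : ℝ => ((I.filter fun x => s ≤ f x).card : ℝ)) =
      fun s => ∑ x ∈ I, {s | s ≤ f x}.indicator (fun _ => (1 : ℝ)) s := by
    funext s
    rw [Finset.card_filter]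
    push_cast
    rfl
  have hi : ∀ x ∈ I, IntervalIntegrable ({s | s ≤ f x}.indicator fun _ => (1 : ℝ))
      MeasureTheory.volume 0 1 := fun x _ => intervalIntegrable_indicator_le _
  rw [h]
  refine ⟨IntervalIntegrable.sum (f := fun x => {s | s ≤ f x}.indicator fun _ => (1 : ℝ)) I hi |>.congr
    (fun s _ => Finset.sum_apply _ _ _), ?_⟩
  rw [intervalIntegral.integral_finsetSum hi]
  exact Finset.sum_congr rfl fun x hx => integral_indicator_le_eq (hf x hx)

/-- A one-dimensional discrete Prékopa–Leindler inequality for normalized functions. -/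
lemma sum_add_sum_le_of_min_le {f g h : ℤ → ℝ} {I J K : Finset ℤ}
    (hf : ∀ x ∈ I, 0 ≤ f x ∧ f x ≤ 1) (hf1 : ∃ x ∈ I, f x = 1)
    (hg : ∀ x ∈ J, 0 ≤ g x ∧ g x ≤ 1) (hg1 : ∃ x ∈ J, g x = 1)
    (hh : ∀ z ∈ K, 0 ≤ h z)
    (hfg : ∀ x ∈ I, ∀ y ∈ J, x + y ∈ K ∧ min (f x) (g y) ≤ h (x + y)) :
    ∑ x ∈ I, f x + ∑ y ∈ J, g y - 1 ≤ ∑ z ∈ K, h z := by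
  obtain ⟨fi, fe⟩ := integral_card_filter_le I f fun x hx => (hf x hx).1
  obtain ⟨gi, ge⟩ := integral_card_filter_le J g fun x hx => (hg x hx).1
  obtain ⟨hi, he⟩ := integral_card_filter_le K h hh
  rw [Finset.sum_congr rfl fun x hx => min_eq_left (hf x hx).2] at fe
  rw [Finset.sum_congr rfl fun x hx => min_eq_left (hg x hx).2] at ge
  have hle : ∑ z ∈ K, min (h z) 1 ≤ ∑ z ∈ K, h z := Finset.sum_le_sum fun z _ => min_le_left _ _
  rw [← he] at hle
  refine le_trans ?_ hle
  rw [← fe, ← ge, ← intervalIntegral.integral_add fi gi]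
  have hone : ∫ _s in (0 : ℝ)..1, (1 : ℝ) = 1 := by simp
  rw [sub_le_iff_le_add]
  conv_rhs => arg 2; rw [← hone]
  rw [← intervalIntegral.integral_add hi (by simp)]
  refine intervalIntegral.integral_mono_on zero_le_one (fi.add gi) (hi.add (by simp)) ?_
  intro s hs
  obtain ⟨x₀, hx₀, hx₁⟩ := hf1
  obtain ⟨y₀, hy₀, hy₁⟩ := hg1
  have hF : (I.filter fun x => s ≤ f x).Nonempty := ⟨x₀, by simp [hx₀, hx₁, hs.2]⟩
  have hG : (J.filter fun x => s ≤ g x).Nonempty := ⟨y₀, by simp [hy₀, hy₁, hs.2]⟩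
  have h1 := cauchy_davenport_add_of_linearOrder_isCancelAdd hF hG
  have h2 : (I.filter fun x => s ≤ f x) + (J.filter fun x => s ≤ g x) ⊆
      K.filter fun z => s ≤ h z := by
    intro z hz
    obtain ⟨x, hx, y, hy, rfl⟩ := Finset.mem_add.1 hz
    rw [Finset.mem_filter] at hx hy ⊢
    obtain ⟨h3, h4⟩ := hfg x hx.1 y hy.1
    exact ⟨h3, (le_min hx.2 hy.2).trans h4⟩
  have h3 := h1.trans (Finset.card_le_card h2)
  have h4 : (I.filter fun x => s ≤ f x).card + (J.filter fun x => s ≤ g x).card ≤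
      (K.filter fun z => s ≤ h z).card + 1 := by omega
  have h5 : ((I.filter fun x => s ≤ f x).card : ℝ) + (J.filter fun x => s ≤ g x).card ≤
      (K.filter fun z => s ≤ h z).card + 1 := by exact_mod_cast h4
  exact h5

/-- A one-dimensional discrete Prékopa–Leindler inequality. -/
lemma two_mul_sqrt_sum_mul_sum_le {f g h : ℤ → ℝ} {I J K : Finset ℤ} {V : ℝ} (hV0 : 0 ≤ V)
    (hf : ∀ x ∈ I, 0 ≤ f x ∧ f x ≤ V) (hg : ∀ x ∈ J, 0 ≤ g x ∧ g x ≤ V)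
    (hh : ∀ z ∈ K, 0 ≤ h z)
    (hfg : ∀ x ∈ I, ∀ y ∈ J, x + y ∈ K ∧ √(f x * g y) ≤ h (x + y)) :
    2 * √((∑ x ∈ I, f x) * ∑ y ∈ J, g y) ≤ ∑ z ∈ K, h z + V := by
  have hS : 0 ≤ ∑ z ∈ K, h z := Finset.sum_nonneg hh
  by_cases hI : ∃ x ∈ I, f x ≠ 0
  swap
  · push Not at hI
    rw [Finset.sum_eq_zero hI]
    simp only [zero_mul, Real.sqrt_zero]
    linarith
  by_cases hJ : ∃ x ∈ J, g x ≠ 0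
  swap
  · push Not at hJ
    rw [Finset.sum_eq_zero hJ]
    simp only [mul_zero, Real.sqrt_zero]
    linarith
  obtain ⟨x₁, hx₁, hx₁0⟩ := hI
  obtain ⟨y₁, hy₁, hy₁0⟩ := hJ
  obtain ⟨x₀, hx₀, hxmax⟩ := I.exists_max_image f ⟨x₁, hx₁⟩
  obtain ⟨y₀, hy₀, hymax⟩ := J.exists_max_image g ⟨y₁, hy₁⟩
  have ha : 0 < f x₀ := ((hf x₁ hx₁).1.lt_of_ne' hx₁0).trans_le (hxmax x₁ hx₁)
  have hb : 0 < g y₀ := ((hg y₁ hy₁).1.lt_of_ne' hy₁0).trans_le (hymax y₁ hy₁)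
  set a := f x₀
  set b := g y₀
  set c := √(a * b)
  have hc : 0 < c := Real.sqrt_pos.2 (by positivity)
  have hcV : c ≤ V := by
    rw [← Real.sqrt_mul_self hV0]
    exact Real.sqrt_le_sqrt (mul_le_mul (hf x₀ hx₀).2 (hg y₀ hy₀).2 hb.le hV0)
  have key := sum_add_sum_le_of_min_le (f := fun x => f x / a) (g := fun y => g y / b)
    (h := fun z => h z / c) (I := I) (J := J) (K := K)
    (fun x hx => ⟨div_nonneg (hf x hx).1 ha.le, (div_le_one ha).2 (hxmax x hx)⟩)
    ⟨x₀, hx₀, div_self ha.ne'⟩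
    (fun y hy => ⟨div_nonneg (hg y hy).1 hb.le, (div_le_one hb).2 (hymax y hy)⟩)
    ⟨y₀, hy₀, div_self hb.ne'⟩
    (fun z hz => div_nonneg (hh z hz) hc.le) (fun x hx y hy => by
      obtain ⟨h1, h2⟩ := hfg x hx y hy
      refine ⟨h1, ?_⟩
      have hp : 0 ≤ f x / a := div_nonneg (hf x hx).1 ha.le
      have hq : 0 ≤ g y / b := div_nonneg (hg y hy).1 hb.le
      calc min (f x / a) (g y / b) ≤ √(f x / a * (g y / b)) := by
            refine Real.le_sqrt_of_sq_le ?_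
            rw [sq]
            exact mul_le_mul (min_le_left _ _) (min_le_right _ _) (le_min hp hq) hp
        _ = √(f x * g y) / c := by
            rw [div_mul_div_comm, Real.sqrt_div (mul_nonneg (hf x hx).1 (hg y hy).1)]
        _ ≤ _ := by gcongr)
  rw [← Finset.sum_div, ← Finset.sum_div, ← Finset.sum_div] at key
  set F := ∑ x ∈ I, f x
  set G := ∑ y ∈ J, g y
  have hF : 0 ≤ F := Finset.sum_nonneg fun x hx => (hf x hx).1
  have hG : 0 ≤ G := Finset.sum_nonneg fun x hx => (hg x hx).1
  have hFG : √(F * G) = c * √(F / a * (G / b)) := by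
    rw [← Real.sqrt_mul (by positivity)]
    congr 1
    field_simp
  have hamgm : 2 * √(F / a * (G / b)) ≤ F / a + G / b := by
    have hp : 0 ≤ F / a := by positivity
    have hq : 0 ≤ G / b := by positivity
    rw [Real.sqrt_mul hp]
    nlinarith [sq_nonneg (√(F / a) - √(G / b)), Real.sq_sqrt hp, Real.sq_sqrt hq]
  have h3 : 2 * √(F / a * (G / b)) ≤ (∑ z ∈ K, h z) / c + 1 := by linarith
  calc 2 * √(F * G) = c * (2 * √(F / a * (G / b))) := by rw [hFG]; ring
    _ ≤ c * ((∑ z ∈ K, h z) / c + 1) := by gcongr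
    _ = ∑ z ∈ K, h z + c := by field_simp
    _ ≤ _ := by gcongr

section BrunnMinkowski

variable {ι : Type*} [Fintype ι] [DecidableEq ι]

lemma card_le_prod_of_agree {l : ι → ℕ} {B : Finset ι} {S : Finset (ι → ℤ)}
    (hS : ∀ s ∈ S, ∀ s' ∈ S, ∀ i ∉ B, s i = s' i) (hl : ∀ s ∈ S, ∀ i ∈ B, |s i| ≤ l i) :
    S.card ≤ ∏ i ∈ B, (2 * l i + 1) := by
  have h1 : S.card ≤ (intBox fun i => if i ∈ B then l i else 0).card := by
    refine Finset.card_le_card_of_injOn (fun s i => if i ∈ B then s i else 0) ?_ ?_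
    · intro s hs
      rw [Finset.mem_coe, mem_intBox]
      intro i
      by_cases hi : i ∈ B
      · simpa [hi] using hl s hs i hi
      · simp [hi]
    · intro s hs s' hs' h
      funext i
      by_cases hi : i ∈ B
      · simpa [hi] using congrFun h i
      · exact hS s hs s' hs' i hi
  refine h1.trans (le_of_eq ?_)
  rw [card_intBox, ← Finset.prod_subset (Finset.subset_univ B)]
  · exact Finset.prod_congr rfl fun i hi => by simp [hi]
  · intro i _ hi
    simp [hi]

/-- A discrete Brunn–Minkowski inequality in boxes with long sides. -/
theorem two_pow_mul_sqrt_card_mul_card_le (l : ι → ℕ) {H : ℕ} (hH : 1 ≤ H) (B : Finset ι) :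
    (∀ i ∈ B, H ≤ l i) → ∀ S T : Finset (ι → ℤ),
    (∀ s ∈ S, ∀ s' ∈ S, ∀ i ∉ B, s i = s' i) → (∀ s ∈ T, ∀ s' ∈ T, ∀ i ∉ B, s i = s' i) →
    (∀ s ∈ S, ∀ i ∈ B, |s i| ≤ l i) → (∀ s ∈ T, ∀ i ∈ B, |s i| ≤ l i) →
    2 ^ B.card * √((S.card : ℝ) * T.card) ≤
      (S + T).card + (B.card * 2 ^ B.card / H) * ∏ i ∈ B, (2 * (l i : ℝ) + 1) := by
  induction B using Finset.induction with
  | empty =>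
    intro _ S T hS hT _ _
    rcases S.eq_empty_or_nonempty with rfl | hSn
    · simp
    rcases T.eq_empty_or_nonempty with rfl | hTn
    · simp
    have h1 : S.card ≤ 1 := Finset.card_le_one.2 fun a ha b hb =>
      funext fun i => hS a ha b hb i (by simp)
    have h2 : T.card ≤ 1 := Finset.card_le_one.2 fun a ha b hb =>
      funext fun i => hT a ha b hb i (by simp)
    have h3 : 1 ≤ (S + T).card := (hSn.add hTn).card_pos
    have h1' : (S.card : ℝ) ≤ 1 := by exact_mod_cast h1
    have h2' : (T.card : ℝ) ≤ 1 := by exact_mod_cast h2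
    have h3' : (1 : ℝ) ≤ (S + T).card := by exact_mod_cast h3
    have h4 : √((S.card : ℝ) * T.card) ≤ 1 := by
      rw [Real.sqrt_le_iff, one_pow]
      exact ⟨zero_le_one, mul_le_one₀ h1' (by positivity) h2'⟩
    simp only [Finset.card_empty, pow_zero, one_mul, Nat.cast_zero, zero_mul, zero_div, add_zero]
    linarith
  | insert j B hj ih =>
    intro hHl S T hS hT hSl hTl
    set V : ℝ := ∏ i ∈ B, (2 * (l i : ℝ) + 1) with hV
    have hV0 : 0 ≤ V := Finset.prod_nonneg fun i _ => by positivity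
    have hH0 : (0 : ℝ) < H := by exact_mod_cast hH
    set E : ℝ := B.card * 2 ^ B.card / H with hE
    have hE0 : 0 ≤ E := by positivity
    have hagree : ∀ U : Finset (ι → ℤ), (∀ s ∈ U, ∀ s' ∈ U, ∀ i ∉ insert j B, s i = s' i) →
        ∀ x, ∀ s ∈ U.filter (· j = x), ∀ s' ∈ U.filter (· j = x), ∀ i ∉ B, s i = s' i := by
      intro U hU x s hs s' hs' i hi
      rw [Finset.mem_filter] at hs hs'
      by_cases hij : i = j
      · rw [hij, hs.2, hs'.2]
      · exact hU s hs.1 s' hs'.1 i (by simp [hij, hi])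
    have hbox : ∀ U : Finset (ι → ℤ), (∀ s ∈ U, ∀ i ∈ insert j B, |s i| ≤ l i) →
        ∀ x, ∀ s ∈ U.filter (· j = x), ∀ i ∈ B, |s i| ≤ l i := fun U hU x s hs i hi =>
      hU s (Finset.mem_filter.1 hs).1 i (Finset.mem_insert_of_mem hi)
    have hcard : ∀ U : Finset (ι → ℤ), (∀ s ∈ U, ∀ s' ∈ U, ∀ i ∉ insert j B, s i = s' i) →
        (∀ s ∈ U, ∀ i ∈ insert j B, |s i| ≤ l i) → ∀ x,
        ((U.filter (· j = x)).card : ℝ) ≤ V := fun U hU hU' x => by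
      have := card_le_prod_of_agree (hagree U hU x) (hbox U hU' x)
      rw [hV]
      exact_mod_cast this
    have hsum : ∀ U : Finset (ι → ℤ), (∀ s ∈ U, ∀ i ∈ insert j B, |s i| ≤ l i) →
        (U.card : ℝ) = ∑ x ∈ Finset.Icc (-(l j : ℤ)) (l j), ((U.filter (· j = x)).card : ℝ) := by
      intro U hU
      rw [Finset.card_eq_sum_card_fiberwise (f := fun s => s j)
        (t := Finset.Icc (-(l j : ℤ)) (l j))]
      · push_cast
        rfl
      · intro s hs
        simpa [abs_le] using hU s hs j (by simp)
    have key := two_mul_sqrt_sum_mul_sum_le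
      (f := fun x => ((S.filter (· j = x)).card : ℝ))
      (g := fun x => ((T.filter (· j = x)).card : ℝ))
      (h := fun z => ((((S + T).filter (· j = z)).card : ℝ) + E * V) / 2 ^ B.card)
      (I := Finset.Icc (-(l j : ℤ)) (l j)) (J := Finset.Icc (-(l j : ℤ)) (l j))
      (K := Finset.Icc (-(2 * l j : ℤ)) (2 * l j)) hV0
      (fun x _ => ⟨by positivity, hcard S hS hSl x⟩)
      (fun x _ => ⟨by positivity, hcard T hT hTl x⟩) (fun z _ => by positivity)
      (fun x hx y hy => by
        rw [Finset.mem_Icc] at hx hy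
        refine ⟨by rw [Finset.mem_Icc]; constructor <;> linarith, ?_⟩
        rw [le_div_iff₀ (by positivity), mul_comm]
        refine (ih (fun i hi => hHl i (Finset.mem_insert_of_mem hi)) _ _ (hagree S hS x)
          (hagree T hT y) (hbox S hSl x) (hbox T hTl y)).trans ?_
        gcongr
        intro z hz
        obtain ⟨s, hs, t, ht, rfl⟩ := Finset.mem_add.1 hz
        rw [Finset.mem_filter] at hs ht ⊢
        exact ⟨Finset.add_mem_add hs.1 ht.1, by simp [hs.2, ht.2]⟩)
    rw [← hsum S hSl, ← hsum T hTl, ← Finset.sum_div, Finset.sum_add_distrib, Finset.sum_const,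
      Int.card_Icc] at key
    have hST : ((S + T).card : ℝ) = ∑ x ∈ Finset.Icc (-(2 * l j : ℤ)) (2 * l j),
        (((S + T).filter (· j = x)).card : ℝ) := by
      rw [Finset.card_eq_sum_card_fiberwise (f := fun s => s j)
        (t := Finset.Icc (-(2 * l j : ℤ)) (2 * l j))]
      · push_cast
        rfl
      · intro z hz
        obtain ⟨s, hs, t, ht, rfl⟩ := Finset.mem_add.1 hz
        have h1 := abs_le.1 (hSl s hs j (by simp))
        have h2 := abs_le.1 (hTl t ht j (by simp))
        simp only [Finset.coe_Icc, mem_Icc, Pi.add_apply]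
        constructor <;> linarith
    rw [← hST] at key
    have hnat : (2 * (l j : ℤ) + 1 - -(2 * l j)).toNat = 4 * l j + 1 := by omega
    rw [hnat, nsmul_eq_mul] at key
    rw [Finset.card_insert_of_notMem hj, Finset.prod_insert hj, ← hV]
    have hHj : (H : ℝ) ≤ l j := by exact_mod_cast hHl j (by simp)
    have hp : (0 : ℝ) < 2 ^ B.card := by positivity
    have k2 : 2 ^ (B.card + 1) * √((S.card : ℝ) * T.card) ≤
        (S + T).card + (4 * l j + 1) * (E * V) + 2 ^ B.card * V := by
      calc 2 ^ (B.card + 1) * √((S.card : ℝ) * T.card)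
          = 2 ^ B.card * (2 * √((S.card : ℝ) * T.card)) := by ring
        _ ≤ _ := mul_le_mul_of_nonneg_left key hp.le
        _ = _ := by push_cast; field_simp
    refine k2.trans ?_
    have h5 : (4 * (l j : ℝ) + 1) * (E * V) ≤ 2 * E * ((2 * l j + 1) * V) := by
      nlinarith [mul_nonneg hE0 hV0]
    have h6 : 2 ^ B.card * V ≤ (2 ^ (B.card + 1) / H) * ((2 * l j + 1) * V) := by
      have : 2 ^ B.card * V = (2 ^ B.card / H) * (H * V) := by field_simp
      rw [this]
      gcongr
      · norm_num
      · exact Nat.le_succ _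
      · linarith
    have h7 : (((B.card + 1 : ℕ) : ℝ) * 2 ^ (B.card + 1) / H) = 2 * E + 2 ^ (B.card + 1) / H := by
      rw [hE]
      push_cast
      ring
    rw [h7]
    linarith [add_mul (2 * E) (2 ^ (B.card + 1) / (H : ℝ)) ((2 * l j + 1) * V)]

end BrunnMinkowski

/-- Setting the coordinates in `B` to zero. -/
def eraseCoords {ι : Type*} [DecidableEq ι] (B : Finset ι) : (ι → ℤ) →+ (ι → ℤ) where
  toFun z i := if i ∈ B then 0 else z i
  map_zero' := by
    funext i
    simp
  map_add' x y := by
    funext i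
    by_cases h : i ∈ B <;> simp [h]

lemma eraseCoords_apply {ι : Type*} [DecidableEq ι] (B : Finset ι) (z : ι → ℤ) (i : ι) :
    eraseCoords B z i = if i ∈ B then 0 else z i := rfl

/-- A set of doubling less than `2 ^ d` in a box with at least `d` long sides lies in a single
translate of a coordinate subspace of dimension `d`. -/
theorem eq_of_card_add_self_lt {ι : Type*} [Fintype ι] [DecidableEq ι] {l : ι → ℕ} {B : Finset ι}
    {C d H : ℕ} {A : Finset (ι → ℤ)} (hA : A.Nonempty) (hAl : A ⊆ intBox l)
    (hN : ∏ i ∈ Bᶜ, (2 * l i + 1) ≤ C) (hC : ∏ i, (2 * l i + 1) ≤ C * A.card)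
    (hdbl : (A + A).card < 2 ^ d * A.card) (hd : d ≤ B.card)
    (hH : C ^ 3 * (B.card * 2 ^ B.card) * 2 ^ (d + 1) + 1 ≤ H) (hB : ∀ i ∈ B, H ≤ l i) :
    B.card = d ∧ ∀ s ∈ A, ∀ s' ∈ A, ∀ i ∉ B, s i = s' i := by
  set π := eraseCoords B
  set X := A.image π
  set n : (ι → ℤ) → ℝ := fun w => ((A.filter (π · = w)).card : ℝ) with hn
  set m : (ι → ℤ) → ℝ := fun w => (((A + A).filter (π · = w)).card : ℝ) with hm
  set k := B.card
  set V : ℝ := ∏ i ∈ B, (2 * (l i : ℝ) + 1) with hV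
  set E : ℝ := k * 2 ^ k / H with hE
  have hV0 : 0 ≤ V := Finset.prod_nonneg fun i _ => by positivity
  have hE0 : 0 ≤ E := by positivity
  have hH0 : (0 : ℝ) < H := by
    have : 0 < H := by omega
    exact_mod_cast this
  set η := E * V with hη
  have hη0 : 0 ≤ η := by positivity
  have hAc : (0 : ℝ) < A.card := by exact_mod_cast hA.card_pos
  have hXn : X.Nonempty := hA.image _
  have hXC : (X.card : ℝ) ≤ C := by
    have : X.card ≤ ∏ i ∈ Bᶜ, (2 * l i + 1) := by
      refine card_le_prod_of_agree ?_ ?_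
      · intro s hs s' hs' i hi
        obtain ⟨a, _, rfl⟩ := Finset.mem_image.1 hs
        obtain ⟨a', _, rfl⟩ := Finset.mem_image.1 hs'
        have hi : i ∈ B := by simpa using hi
        simp [π, eraseCoords_apply, hi]
      · intro s hs i hi
        obtain ⟨a, ha, rfl⟩ := Finset.mem_image.1 hs
        have hi : i ∉ B := by simpa using hi
        simpa [π, eraseCoords_apply, hi] using mem_intBox.1 (hAl ha) i
    exact_mod_cast this.trans hN
  have hC0 : (0 : ℝ) < C := lt_of_lt_of_le (by exact_mod_cast hXn.card_pos) hXC
  have hVA : V ≤ C * A.card := by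
    have h1 : ∏ i ∈ B, (2 * l i + 1) ≤ ∏ i, (2 * l i + 1) :=
      Finset.prod_le_prod_of_subset_of_one_le' (Finset.subset_univ B) fun i _ _ => by omega
    rw [hV]
    exact_mod_cast h1.trans hC
  obtain ⟨w₀, hw₀, hmax⟩ := X.exists_max_image n hXn
  have hsum : (A.card : ℝ) = ∑ w ∈ X, n w := by
    rw [Finset.card_eq_sum_card_fiberwise (f := π) (t := X)
      fun a ha => Finset.mem_image_of_mem _ ha]
    push_cast
    rfl
  have hAn : (A.card : ℝ) ≤ C * n w₀ := by
    rw [hsum]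
    refine (Finset.sum_le_card_nsmul X n _ hmax).trans ?_
    rw [nsmul_eq_mul]
    gcongr
  have hEC : 2 ^ (d + 1) * (C ^ 3 * E) ≤ 1 := by
    rw [hE, ← mul_div_assoc, ← mul_div_assoc, div_le_one hH0]
    have : C ^ 3 * (k * 2 ^ k) * 2 ^ (d + 1) ≤ H := by omega
    have h2 : (C : ℝ) ^ 3 * (k * 2 ^ k) * 2 ^ (d + 1) ≤ H := by exact_mod_cast this
    linarith
  have hsmall : 2 ^ (d + 1) * (X.card * η) ≤ n w₀ := by
    refine le_of_mul_le_mul_left ?_ hC0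
    refine le_trans ?_ hAn
    calc (C : ℝ) * (2 ^ (d + 1) * (X.card * η))
        ≤ C * (2 ^ (d + 1) * (C * (E * (C * A.card)))) := by rw [hη]; gcongr
      _ = 2 ^ (d + 1) * (C ^ 3 * E) * A.card := by ring
      _ ≤ 1 * A.card := by gcongr
      _ = A.card := one_mul _
  have hfib : ∀ w ∈ X, (A.filter (π · = w)).Nonempty := by
    intro w hw
    obtain ⟨a, ha, rfl⟩ := Finset.mem_image.1 hw
    exact ⟨a, by simp [ha]⟩
  have hadd : ∀ x y, A.filter (π · = x) + A.filter (π · = y) ⊆ (A + A).filter (π · = x + y) := by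
    intro x y z hz
    obtain ⟨s, hs, t, ht, rfl⟩ := Finset.mem_add.1 hz
    rw [Finset.mem_filter] at hs ht ⊢
    exact ⟨Finset.add_mem_add hs.1 ht.1, by rw [map_add, hs.2, ht.2]⟩
  have hmn : ∀ x, ∀ y ∈ X, n x ≤ m (x + y) := fun x y hy => by
    have := (Finset.card_le_card_add_right (hfib y hy)).trans (Finset.card_le_card (hadd x y))
    simp only [hn, hm]
    exact_mod_cast this
  have hagree : ∀ w, ∀ s ∈ A.filter (π · = w), ∀ s' ∈ A.filter (π · = w), ∀ i ∉ B,
      s i = s' i := by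
    intro w s hs s' hs' i hi
    have := congrFun ((Finset.mem_filter.1 hs).2.trans (Finset.mem_filter.1 hs').2.symm) i
    simpa [π, eraseCoords_apply, hi] using this
  have hbox : ∀ w, ∀ s ∈ A.filter (π · = w), ∀ i ∈ B, |s i| ≤ l i := fun w s hs i _ =>
    mem_intBox.1 (hAl (Finset.mem_filter.1 hs).1) i
  have hbm : ∀ w ∈ X, 2 ^ k * n w - η ≤ m (w₀ + w) := by
    intro w hw
    have h1 := two_pow_mul_sqrt_card_mul_card_le l (H := H) (by omega) B hB
      (A.filter (π · = w₀)) (A.filter (π · = w)) (hagree _) (hagree _) (hbox _) (hbox _)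
    have h2 : ((A.filter (π · = w₀) + A.filter (π · = w)).card : ℝ) ≤ m (w₀ + w) := by
      simp only [hm]
      exact_mod_cast Finset.card_le_card (hadd w₀ w)
    have h3 : n w ≤ √(n w₀ * n w) := by
      refine Real.le_sqrt_of_sq_le ?_
      rw [sq]
      exact mul_le_mul_of_nonneg_right (hmax w hw) (Nat.cast_nonneg _)
    have h4 : (2 : ℝ) ^ k * n w ≤ 2 ^ k * √(n w₀ * n w) := by gcongr
    linarith
  have hfibsum : ∀ Y : Finset (ι → ℤ), ∑ z ∈ Y, m z ≤ (A + A).card := by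
    intro Y
    have h1 : ∑ z ∈ Y, m z = ((Y.biUnion fun z => (A + A).filter (π · = z)).card : ℝ) := by
      rw [Finset.card_biUnion]
      · push_cast
        rfl
      · intro x _ y _ hxy
        rw [Function.onFun, Finset.disjoint_left]
        intro a ha hb
        exact hxy ((Finset.mem_filter.1 ha).2.symm.trans (Finset.mem_filter.1 hb).2)
    rw [h1]
    norm_cast
    refine Finset.card_le_card fun a ha => ?_
    obtain ⟨z, _, hz⟩ := Finset.mem_biUnion.1 ha
    exact (Finset.mem_filter.1 hz).1
  have hinj : ∀ F : (ι → ℤ) → ℝ, ∑ z ∈ X.image (w₀ + ·), F z = ∑ w ∈ X, F (w₀ + w) := fun F =>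
    Finset.sum_image fun a _ b _ h => add_left_cancel h
  have hbase : 2 ^ k * A.card - X.card * η ≤ ∑ w ∈ X, m (w₀ + w) := by
    have := Finset.sum_le_sum hbm
    rwa [Finset.sum_sub_distrib, ← Finset.mul_sum, ← hsum, Finset.sum_const, nsmul_eq_mul] at this
  have hdblR : ((A + A).card : ℝ) < 2 ^ d * A.card := by exact_mod_cast hdbl
  have hn0 : 0 < n w₀ := by
    simp only [hn]
    exact_mod_cast (hfib w₀ hw₀).card_pos
  have hn0A : n w₀ ≤ A.card := by
    simp only [hn]
    exact_mod_cast Finset.card_filter_le _ _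
  have hp : (0 : ℝ) < 2 ^ (d + 1) := by positivity
  have hXη : X.card * η ≤ n w₀ / 2 ^ (d + 1) := by
    rw [le_div_iff₀ hp]
    linarith
  have hp2 : (2 : ℝ) ≤ 2 ^ (d + 1) := by
    rw [pow_succ]
    nlinarith [one_le_pow₀ (M₀ := ℝ) one_le_two (n := d)]
  have hhalf : n w₀ / 2 ^ (d + 1) ≤ n w₀ / 2 := by gcongr
  have hkd : k = d := by
    by_contra hne
    have hlt : d + 1 ≤ k := by omega
    have h1 := hinj m ▸ hfibsum (X.image (w₀ + ·))
    have h2 : (2 : ℝ) ^ (d + 1) * A.card ≤ 2 ^ k * A.card := by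
      gcongr
      norm_num
    have h3 : (1 : ℝ) * A.card ≤ 2 ^ d * A.card := by
      gcongr
      exact one_le_pow₀ one_le_two
    rw [pow_succ] at h2
    linarith
  refine ⟨hkd, ?_⟩
  have hcontra : X.card ≤ 1 := by
    by_contra! hX2
    by_cases hall : ∃ w ∈ X, 2 ^ (d + 1) * n w ≤ n w₀
    · obtain ⟨w₁, hw₁, hw₁n⟩ := hall
      have h1 : 2 ^ k * n w₁ + n w₀ / 2 ≤ m (w₀ + w₁) := by
        refine le_trans ?_ (hmn w₀ w₁ hw₁)
        rw [hkd]
        rw [pow_succ] at hw₁n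
        linarith
      have h2 : ∀ w ∈ X, 2 ^ k * n w - η + (if w = w₁ then n w₀ / 2 else 0) ≤ m (w₀ + w) := by
        intro w hw
        split_ifs with h
        · rw [h]
          linarith
        · rw [add_zero]
          exact hbm w hw
      have h3 := Finset.sum_le_sum h2
      rw [Finset.sum_add_distrib, Finset.sum_sub_distrib, ← Finset.mul_sum, ← hsum,
        Finset.sum_const, nsmul_eq_mul, Finset.sum_ite_eq' X w₁, if_pos hw₁] at h3
      have h4 := hinj m ▸ hfibsum (X.image (w₀ + ·))
      rw [hkd] at h3
      linarith
    · push Not at hall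
      have h1 := cauchy_davenport_of_isAddTorsionFree hXn hXn
      have h2 : ¬ X + X ⊆ X.image (w₀ + ·) := fun h => by
        have := (Finset.card_le_card h).trans Finset.card_image_le
        omega
      obtain ⟨z, hz, hz'⟩ := Finset.not_subset.1 h2
      obtain ⟨x, hx, y, hy, rfl⟩ := Finset.mem_add.1 hz
      have h3 := hfibsum (insert (x + y) (X.image (w₀ + ·)))
      rw [Finset.sum_insert hz', hinj] at h3
      have h4 : n w₀ / 2 ^ (d + 1) < m (x + y) := by
        refine lt_of_lt_of_le ?_ (hmn x y hy)
        rw [div_lt_iff₀ hp]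
        linarith [hall x hx]
      rw [hkd] at hbase
      linarith
  intro s hs s' hs' i hi
  have := congrFun (Finset.card_le_one.1 hcontra _ (Finset.mem_image_of_mem π hs) _
    (Finset.mem_image_of_mem π hs')) i
  simpa [π, eraseCoords_apply, hi] using this

lemma IsGAP.zero : IsGAP 0 {0} :=
  ⟨Fin.elim0, Fin.elim0, fun i => i.elim0, by
    ext x
    simp⟩

lemma IsGAP.succ {n : ℕ} {P : Set ℤ} (hP : IsGAP n P) (a : ℤ) {L : ℕ} (hL : 1 ≤ L) :
    IsGAP (n + 1) {x | ∃ lam : ℕ, (1 ≤ lam ∧ lam ≤ L) ∧ ∃ p ∈ P, x = lam * a + p} := by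
  obtain ⟨b, l, hl, rfl⟩ := hP
  refine ⟨Fin.cons a b, Fin.cons L l, fun i => Fin.cases hL hl i, ?_⟩
  ext x
  constructor
  · rintro ⟨lam, h1, p, ⟨mu, hmu, rfl⟩, rfl⟩
    refine ⟨Fin.cons lam mu, fun i => Fin.cases h1 hmu i, ?_⟩
    simp [Fin.sum_univ_succ]
  · rintro ⟨mu, hmu, rfl⟩
    refine ⟨mu 0, by simpa using hmu 0, ∑ i : Fin n, (mu i.succ : ℤ) * b i,
      ⟨fun i => mu i.succ, fun i => by simpa using hmu i.succ, rfl⟩, ?_⟩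
    simp [Fin.sum_univ_succ]

lemma IsGAP.mono {n m : ℕ} (h : n ≤ m) {P : Set ℤ} (hP : IsGAP n P) : IsGAP m P := by
  induction m, h using Nat.le_induction with
  | base => exact hP
  | succ m _ ih =>
    convert ih.succ 0 le_rfl using 1
    ext x
    simp only [mul_zero, zero_add, exists_eq_right', mem_ofPred_eq]
    exact ⟨fun h => ⟨1, by simp, h⟩, fun h => h.choose_spec.2⟩

lemma isGAP_image_intBox {ι : Type*} [Fintype ι] [DecidableEq ι] (φ : (ι → ℤ) →+ ℤ) (l : ι → ℕ)
    (B : Finset ι) : ∃ c : ℤ, IsGAP B.card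
      {x | ∃ z ∈ intBox l, (∀ i ∉ B, z i = 0) ∧ x = c + φ z} := by
  induction B using Finset.induction with
  | empty =>
    refine ⟨0, ?_⟩
    rw [Finset.card_empty]
    convert IsGAP.zero
    ext x
    constructor
    · rintro ⟨z, _, hz, rfl⟩
      have : z = 0 := funext fun i => hz i (by simp)
      simp [this]
    · rintro rfl
      exact ⟨0, zero_mem_intBox l, by simp, by simp⟩
  | insert j B hj ih =>
    obtain ⟨c, hc⟩ := ih
    refine ⟨c + (l j + 1) * φ (Pi.single j 1), ?_⟩
    rw [Finset.card_insert_of_notMem hj]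
    convert hc.succ (φ (Pi.single j 1)) (L := 2 * l j + 1) (by omega) using 1
    have hφ : ∀ n : ℤ, φ (Pi.single j n) = n * φ (Pi.single j 1) := fun n => by
      rw [← smul_eq_mul, ← map_zsmul, ← Pi.single_smul, smul_eq_mul, mul_one]
    ext x
    constructor
    · rintro ⟨z, hz, hz0, rfl⟩
      have hzj := abs_le.1 (mem_intBox.1 hz j)
      refine ⟨(z j + l j + 1).toNat, by omega, _,
        ⟨Function.update z j 0, ?_, ?_, rfl⟩, ?_⟩
      · rw [mem_intBox]
        intro i
        by_cases h : i = j
        · subst h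
          simp
        · simpa [h] using mem_intBox.1 hz i
      · intro i hi
        by_cases h : i = j
        · subst h
          simp
        · simpa [h] using hz0 i (by simp [h, hi])
      · have hsplit : z = Pi.single j (z j) + Function.update z j 0 := by
          funext i
          by_cases h : i = j
          · subst h
            simp
          · simp [h]
        have h1 : φ z = z j * φ (Pi.single j 1) + φ (Function.update z j 0) := by
          conv_lhs => rw [hsplit]
          rw [map_add, hφ]
        rw [h1, Int.toNat_of_nonneg (by omega)]
        ring
    · rintro ⟨lam, hlam, _, ⟨z, hz, hz0, rfl⟩, rfl⟩
      refine ⟨z + Pi.single j ((lam : ℤ) - l j - 1), ?_, ?_, ?_⟩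
      · rw [mem_intBox]
        intro i
        by_cases h : i = j
        · subst h
          simp only [Pi.add_apply, hz0 i hj, Pi.single_eq_same, abs_le]
          omega
        · simpa [h] using mem_intBox.1 hz i
      · intro i hi
        rw [Finset.mem_insert, not_or] at hi
        simp [hi.1, hz0 i hi.2]
      · rw [map_add, hφ (_ - _)]
        ring

/-- `A` is either covered by few translates of a `(d - 1)`-dimensional progression or by a single
translate of a `d`-dimensional progression. -/
def Structured (d t : ℕ) (A : Finset ℤ) : Prop :=
  (∃ X P : Set ℤ, X.Finite ∧ X.ncard ≤ t ∧ IsGAP (d - 1) P ∧ ↑A ⊆ X + P ∧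
    (X + P).ncard ≤ t * A.card) ∨
  ∃ (x : ℤ) (P : Set ℤ), IsGAP d P ∧ P.ncard ≤ t * A.card ∧ ↑A ⊆ {x} + P

lemma Structured.mono {d t t' : ℕ} (h : t ≤ t') {A : Finset ℤ} (hA : Structured d t A) :
    Structured d t' A := by
  have ht : t * A.card ≤ t' * A.card := Nat.mul_le_mul_right _ h
  rcases hA with ⟨X, P, h1, h2, h3, h4, h5⟩ | ⟨x, P, h1, h2, h3⟩
  · exact Or.inl ⟨X, P, h1, h2.trans h, h3, h4, h5.trans ht⟩
  · exact Or.inr ⟨x, P, h1, h2.trans ht, h3⟩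

section

variable {ι : Type*} [Fintype ι] [DecidableEq ι] {φ : (ι → ℤ) →+ ℤ} {l : ι → ℕ} {B : Finset ι}
  {C d : ℕ} {A : Finset ℤ}

lemma eraseCoords_mem_intBox {z : ι → ℤ} (hz : z ∈ intBox l) : eraseCoords B z ∈ intBox l := by
  rw [mem_intBox] at hz ⊢
  intro i
  by_cases h : i ∈ B
  · simp [eraseCoords_apply, h]
  · simpa [eraseCoords_apply, h] using hz i

lemma sub_eraseCoords_mem_intBox {z : ι → ℤ} (hz : z ∈ intBox l) :
    z - eraseCoords B z ∈ intBox l := by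
  rw [mem_intBox] at hz ⊢
  intro i
  by_cases h : i ∈ B
  · simpa [eraseCoords_apply, h] using hz i
  · simp [eraseCoords_apply, h]

lemma structured_of_card_lt (hd : B.card < d) (hN : ∏ i ∈ Bᶜ, (2 * l i + 1) ≤ C)
    (hC : ∏ i, (2 * l i + 1) ≤ C * A.card) (hA : ∀ x ∈ A, ∃ z ∈ intBox l, x = φ z) :
    Structured d C A := by
  obtain ⟨c, hc⟩ := isGAP_image_intBox φ l B
  set Y := (intBox l).image (eraseCoords B)
  have hY : Y.card ≤ C := by
    refine le_trans ?_ hN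
    refine card_le_prod_of_agree ?_ ?_
    · intro s hs s' hs' i hi
      obtain ⟨a, _, rfl⟩ := Finset.mem_image.1 hs
      obtain ⟨a', _, rfl⟩ := Finset.mem_image.1 hs'
      have hi : i ∈ B := by simpa using hi
      simp [eraseCoords_apply, hi]
    · intro s hs i _
      obtain ⟨a, ha, rfl⟩ := Finset.mem_image.1 hs
      exact mem_intBox.1 (eraseCoords_mem_intBox ha) i
  refine Or.inl ⟨↑(Y.image fun w => φ w - c), _, Finset.finite_toSet _, ?_,
    hc.mono (by omega), ?_, ?_⟩
  · rw [ncard_coe_finset]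
    exact Finset.card_image_le.trans hY
  · intro x hx
    obtain ⟨z, hz, rfl⟩ := hA x hx
    refine Set.mem_add.2 ⟨φ (eraseCoords B z) - c, ?_, c + φ (z - eraseCoords B z),
      ⟨_, sub_eraseCoords_mem_intBox hz, ?_, rfl⟩, ?_⟩
    · exact Finset.mem_coe.2 (Finset.mem_image_of_mem _ (Finset.mem_image_of_mem _ hz))
    · intro i hi
      simp [eraseCoords_apply, hi]
    · rw [map_sub]
      ring
  · refine le_trans ?_ hC
    rw [← card_intBox l]
    refine le_trans ?_ (Finset.card_image_le (f := φ))
    rw [← ncard_coe_finset]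
    refine ncard_le_ncard ?_ (Finset.finite_toSet _)
    rintro _ ⟨_, hw, _, ⟨z, hz, hz0, rfl⟩, rfl⟩
    obtain ⟨_, hy, rfl⟩ := Finset.mem_image.1 (Finset.mem_coe.1 hw)
    obtain ⟨w, hwl, rfl⟩ := Finset.mem_image.1 hy
    refine Finset.mem_coe.2 (Finset.mem_image.2 ⟨eraseCoords B w + z, ?_, ?_⟩)
    · rw [mem_intBox] at hwl hz ⊢
      intro i
      by_cases h : i ∈ B
      · simpa [eraseCoords_apply, h] using hz i
      · simpa [eraseCoords_apply, h, hz0 i h] using hwl i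
    · rw [map_add]
      simp only
      ring

lemma structured_of_agree (hd : B.card = d) {z₀ : ι → ℤ}
    (hC : ∏ i, (2 * l i + 1) ≤ C * A.card)
    (hA : ∀ x ∈ A, ∃ z ∈ intBox l, x = φ z ∧ ∀ i ∉ B, z i = z₀ i) :
    Structured d C A := by
  obtain ⟨c, hc⟩ := isGAP_image_intBox φ l B
  refine Or.inr ⟨φ (eraseCoords B z₀) - c, _, hd ▸ hc, ?_, ?_⟩
  · refine le_trans ?_ hC
    rw [← card_intBox l]
    refine le_trans ?_ (Finset.card_image_le (f := fun z => c + φ z))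
    rw [← ncard_coe_finset]
    refine ncard_le_ncard ?_ (Finset.finite_toSet _)
    rintro _ ⟨z, hz, _, rfl⟩
    exact Finset.mem_coe.2 (Finset.mem_image_of_mem _ hz)
  · intro x hx
    obtain ⟨z, hz, rfl, hz0⟩ := hA x hx
    have : eraseCoords B z₀ = eraseCoords B z := by
      funext i
      by_cases h : i ∈ B
      · simp [eraseCoords_apply, h]
      · simp [eraseCoords_apply, h, hz0 i h]
    refine Set.mem_add.2 ⟨_, mem_singleton _, c + φ (z - eraseCoords B z),
      ⟨_, sub_eraseCoords_mem_intBox hz, ?_, rfl⟩, ?_⟩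
    · intro i hi
      simp [eraseCoords_apply, hi]
    · rw [map_sub, this]
      ring

/-- The case of a proper progression all of whose sides in `B` are long. -/
lemma structured_of_long_sides {H : ℕ} (hA : A.Nonempty)
    (hdbl : (A + A).card < 2 ^ d * A.card)
    (hinj : ∀ v : ι → ℤ, (∀ i, |v i| ≤ 4 * (l i + 1)) → φ v = 0 → v = 0)
    (hN : ∏ i ∈ Bᶜ, (2 * l i + 1) ≤ C) (hC : ∏ i, (2 * l i + 1) ≤ C * A.card)
    (hH : C ^ 3 * (B.card * 2 ^ B.card) * 2 ^ (d + 1) + 1 ≤ H) (hB : ∀ i ∈ B, H ≤ l i)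
    (hAl : ∀ x ∈ A, ∃ z ∈ intBox l, x = φ z) : Structured d C A := by
  rcases lt_or_ge B.card d with hlt | hge
  · exact structured_of_card_lt hlt hN hC hAl
  choose! z hz hφz using hAl
  set A' := A.image z with hA'
  have hφA' : A'.image φ = A := by
    rw [hA', Finset.image_image]
    ext x
    rw [Finset.mem_image]
    constructor
    · rintro ⟨a, ha, rfl⟩
      rwa [Function.comp_apply, ← hφz a ha]
    · exact fun hx => ⟨x, hx, (hφz x hx).symm⟩
  have hcard : A'.card = A.card := Finset.card_image_of_injOn fun a ha b hb h => by
    rw [hφz a ha, hφz b hb, h]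
  have hA'l : A' ⊆ intBox l := fun w hw => by
    obtain ⟨a, ha, rfl⟩ := Finset.mem_image.1 hw
    exact hz a ha
  have hcard2 : (A' + A').card = (A + A).card := by
    rw [← hφA', ← Finset.image_add, Finset.card_image_of_injOn]
    intro u hu u' hu' h
    obtain ⟨p, hp, q, hq, rfl⟩ := Finset.mem_add.1 (Finset.mem_coe.1 hu)
    obtain ⟨p', hp', q', hq', rfl⟩ := Finset.mem_add.1 (Finset.mem_coe.1 hu')
    refine sub_eq_zero.1 (hinj _ (fun i => ?_) (by rw [map_sub, h, sub_self]))
    have h1 := abs_le.1 (mem_intBox.1 (hA'l hp) i)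
    have h2 := abs_le.1 (mem_intBox.1 (hA'l hq) i)
    have h3 := abs_le.1 (mem_intBox.1 (hA'l hp') i)
    have h4 := abs_le.1 (mem_intBox.1 (hA'l hq') i)
    simp only [Pi.sub_apply, Pi.add_apply, abs_le]
    constructor <;> linarith
  obtain ⟨h1, h2⟩ := eq_of_card_add_self_lt (hA.image z) hA'l hN (hcard.symm ▸ hC)
    (by rw [hcard2, hcard]; exact hdbl) hge hH hB
  obtain ⟨a, ha⟩ := hA
  exact structured_of_agree h1 hC fun x hx => ⟨z x, hz x hx, hφz x hx,
    h2 _ (Finset.mem_image_of_mem z hx) _ (Finset.mem_image_of_mem z ha)⟩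

end

/-- A set of doubling less than `2 ^ d` which is dense in a progression of bounded dimension is
structured. -/
theorem exists_structured (d D : ℕ) : ∀ k C : ℕ, ∃ t : ℕ, ∀ A : Finset ℤ, A.Nonempty →
    (A + A).card < 2 ^ d * A.card → ∀ (φ : (Fin D → ℤ) →+ ℤ) (l : Fin D → ℕ) (B : Finset (Fin D)),
    B.card < k → ∏ i ∈ Bᶜ, (2 * l i + 1) ≤ C → ∏ i, (2 * l i + 1) ≤ C * A.card →
    (∀ x ∈ A, ∃ z ∈ intBox l, x = φ z) → Structured d t A := by
  induction D with
  | zero =>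
    intro k C
    refine ⟨C, fun A hA hdbl φ l B _ hN hC hAl => structured_of_long_sides hA hdbl
      (fun v _ _ => Subsingleton.elim _ _) hN hC le_rfl (fun i => i.elim0) hAl⟩
  | succ D ihD =>
    obtain ⟨C₁, hC₁⟩ := exists_rank_reduction D 4
    intro k
    induction k with
    | zero => exact fun C => ⟨0, fun A _ _ φ l B hB => absurd hB (Nat.not_lt_zero _)⟩
    | succ k ihk =>
      intro C
      set H := C ^ 3 * (k * 2 ^ k) * 2 ^ (d + 1) + 1 with hH
      obtain ⟨t₁, ht₁⟩ := ihD (D + 1) (C₁ * C + 1)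
      obtain ⟨t₂, ht₂⟩ := ihk ((2 * H + 1) * C)
      refine ⟨max C (max t₁ t₂), fun A hA hdbl φ l B hBk hN hC hAl => ?_⟩
      by_cases hinj : ∀ v : Fin (D + 1) → ℤ, (∀ i, |v i| ≤ 4 * (l i + 1)) → φ v = 0 → v = 0
      · by_cases hlong : ∀ i ∈ B, H ≤ l i
        · refine (structured_of_long_sides hA hdbl hinj hN hC ?_ hlong hAl).mono (le_max_left _ _)
          have : B.card ≤ k := by omega
          rw [hH]
          gcongr
          norm_num
        · push Not at hlong
          obtain ⟨i, hi, hli⟩ := hlong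
          refine (ht₂ A hA hdbl φ l (B.erase i) ?_ ?_ ?_ hAl).mono
            ((le_max_right _ _).trans (le_max_right _ _))
          · rw [Finset.card_erase_of_mem hi]
            have := Finset.card_pos.2 ⟨i, hi⟩
            omega
          · rw [Finset.compl_erase, Finset.prod_insert (by simpa using hi)]
            gcongr
          · refine hC.trans ?_
            gcongr
            exact Nat.le_mul_of_pos_left C (by omega)
      · push Not at hinj
        obtain ⟨v, hv, hφv, hv0⟩ := hinj
        obtain ⟨φ', l', h1, h2⟩ := hC₁ φ l v hv0 (by exact_mod_cast hv) hφv
        refine (ht₁ A hA hdbl φ' l' Finset.univ (by simp) (by simp) ?_ ?_).mono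
          ((le_max_left _ _).trans (le_max_right _ _))
        · calc ∏ i, (2 * l' i + 1) ≤ C₁ * ∏ i, (2 * l i + 1) := h2
            _ ≤ C₁ * (C * A.card) := by gcongr
            _ = C₁ * C * A.card := by ring
            _ ≤ (C₁ * C + 1) * A.card := by gcongr; omega
        · intro x hx
          obtain ⟨z, hz, rfl⟩ := hAl x hx
          exact h1 z hz

section Bogolyubov

variable {m : ℕ} [NeZero m]

/-- The Fourier transform of the indicator function of a subset of `ZMod m`. -/
noncomputable def fourierSum (S : Finset (ZMod m)) (r : ZMod m) : ℂ :=
  ∑ s ∈ S, ZMod.stdAddChar (r * s)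

lemma sum_stdAddChar_mul (y : ZMod m) :
    ∑ r : ZMod m, ZMod.stdAddChar (r * y) = if y = 0 then (m : ℂ) else 0 := by
  rw [AddChar.sum_mulShift y (ZMod.isPrimitive_stdAddChar m), ZMod.card]
  split_ifs <;> simp

lemma normSq_fourierSum (S : Finset (ZMod m)) (r : ZMod m) :
    (Complex.normSq (fourierSum S r) : ℂ) =
      ∑ p ∈ S ×ˢ S, ZMod.stdAddChar (r * (p.1 - p.2)) := by
  rw [← Complex.mul_conj, fourierSum, map_sum, Finset.sum_mul_sum, Finset.sum_product]
  refine Finset.sum_congr rfl fun a _ => Finset.sum_congr rfl fun b _ => ?_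
  rw [← AddChar.map_neg_eq_conj, ← AddChar.map_add_eq_mul]
  congr 1
  ring

lemma sum_normSq_fourierSum (S : Finset (ZMod m)) :
    ∑ r, Complex.normSq (fourierSum S r) = m * S.card := by
  have h : ((∑ r, Complex.normSq (fourierSum S r) : ℝ) : ℂ) = ((m * S.card : ℝ) : ℂ) := by
    push_cast
    simp only [normSq_fourierSum]
    rw [Finset.sum_comm]
    simp only [sum_stdAddChar_mul, sub_eq_zero]
    rw [Finset.sum_product]
    simp [mul_comm]
  exact_mod_cast h

lemma sum_normSq_sq_mul_stdAddChar (S : Finset (ZMod m)) {x : ZMod m} (hx : x ∉ 2 • (S - S)) :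
    ∑ r, (Complex.normSq (fourierSum S r) : ℂ) ^ 2 * ZMod.stdAddChar (r * x) = 0 := by
  have h : ∀ r : ZMod m, (Complex.normSq (fourierSum S r) : ℂ) ^ 2 * ZMod.stdAddChar (r * x) =
      ∑ p ∈ S ×ˢ S, ∑ q ∈ S ×ˢ S,
        ZMod.stdAddChar (r * ((p.1 - p.2) + (q.1 - q.2) + x)) := by
    intro r
    rw [sq, normSq_fourierSum, Finset.sum_mul_sum, Finset.sum_mul]
    refine Finset.sum_congr rfl fun p _ => ?_
    rw [Finset.sum_mul]
    refine Finset.sum_congr rfl fun q _ => ?_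
    rw [← AddChar.map_add_eq_mul, ← AddChar.map_add_eq_mul]
    congr 1
    ring
  simp only [h]
  rw [Finset.sum_comm]
  refine Finset.sum_eq_zero fun p hp => ?_
  rw [Finset.sum_comm]
  refine Finset.sum_eq_zero fun q hq => ?_
  rw [sum_stdAddChar_mul, if_neg]
  intro h0
  rw [Finset.mem_product] at hp hq
  refine hx ?_
  rw [two_nsmul]
  have : x = (p.2 - p.1) + (q.2 - q.1) := by linear_combination h0
  rw [this]
  exact Finset.add_mem_add (Finset.sub_mem_sub hp.2 hp.1) (Finset.sub_mem_sub hq.2 hq.1)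

/-- Bogolyubov's lemma. -/
theorem exists_bohr_subset (S : Finset (ZMod m)) (hS : S.Nonempty) : ∃ Γ : Finset (ZMod m),
    Γ.card * S.card ^ 2 ≤ m ^ 2 ∧
    ∀ x, (∀ r ∈ Γ, 0 ≤ (ZMod.stdAddChar (r * x)).re) → x ∈ 2 • (S - S) := by
  classical
  set n : ℝ := (S.card : ℝ)
  have hn : 0 < n := by
    simp only [n]
    exact_mod_cast hS.card_pos
  have hm : (0 : ℝ) < m := by exact_mod_cast Nat.pos_of_neZero m
  have hnm : n ≤ m := by
    have := Finset.card_le_univ S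
    rw [ZMod.card] at this
    simp only [n]
    exact_mod_cast this
  set f : ZMod m → ℝ := fun r => Complex.normSq (fourierSum S r) with hf
  have hf0 : ∀ r, 0 ≤ f r := fun r => Complex.normSq_nonneg _
  have hsum : ∑ r, f r = m * n := sum_normSq_fourierSum S
  have hfz : f 0 = n ^ 2 := by simp [hf, fourierSum, n, sq]
  set Γ := Finset.univ.filter fun r => n ^ 3 / m ≤ f r with hΓ
  have h0Γ : 0 ∈ Γ := by
    rw [hΓ, Finset.mem_filter, hfz, div_le_iff₀ hm]
    exact ⟨Finset.mem_univ _, by nlinarith [sq_nonneg n]⟩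
  have hsplit : ∀ F : ZMod m → ℝ, ∑ r, F r = ∑ r ∈ Γ, F r + ∑ r ∈ Γᶜ, F r := fun F =>
    (Finset.sum_add_sum_compl Γ F).symm
  refine ⟨Γ, ?_, fun x hx => ?_⟩
  · have h1 : Γ.card • (n ^ 3 / m) ≤ ∑ r ∈ Γ, f r :=
      Finset.card_nsmul_le_sum Γ f _ fun r hr => (Finset.mem_filter.1 hr).2
    have h2 : ∑ r ∈ Γ, f r ≤ m * n := by
      rw [← hsum]
      exact Finset.sum_le_univ_sum_of_nonneg hf0
    have h3 := h1.trans h2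
    rw [nsmul_eq_mul, ← mul_div_assoc, div_le_iff₀ hm] at h3
    have h4 : (Γ.card : ℝ) * n ^ 2 ≤ m ^ 2 := by
      refine le_of_mul_le_mul_right ?_ hn
      linarith
    simp only [n] at h4
    exact_mod_cast h4
  · by_contra hx'
    have h1 := congrArg Complex.re (sum_normSq_sq_mul_stdAddChar S hx')
    rw [Complex.re_sum, Complex.zero_re] at h1
    have h2 : ∀ r, ((Complex.normSq (fourierSum S r) : ℂ) ^ 2 * ZMod.stdAddChar (r * x)).re =
        f r ^ 2 * (ZMod.stdAddChar (r * x)).re := by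
      intro r
      rw [← Complex.ofReal_pow, Complex.re_ofReal_mul]
    simp only [h2] at h1
    rw [hsplit] at h1
    have h3 : n ^ 4 ≤ ∑ r ∈ Γ, f r ^ 2 * (ZMod.stdAddChar (r * x)).re := by
      refine le_trans (le_of_eq ?_) (Finset.single_le_sum
        (f := fun r => f r ^ 2 * (ZMod.stdAddChar (r * x)).re)
        (fun r hr => mul_nonneg (sq_nonneg _) (hx r hr)) h0Γ)
      simp only [hfz, zero_mul, AddChar.map_zero_eq_one, Complex.one_re]
      ring
    have h4 : ∀ r ∈ Γᶜ, -(n ^ 3 / m * f r) ≤ f r ^ 2 * (ZMod.stdAddChar (r * x)).re := by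
      intro r hr
      have hr' : f r < n ^ 3 / m := by
        by_contra! h
        exact Finset.mem_compl.1 hr (Finset.mem_filter.2 ⟨Finset.mem_univ _, h⟩)
      have h5 : -1 ≤ (ZMod.stdAddChar (r * x)).re := by
        have := Complex.abs_re_le_norm (ZMod.stdAddChar (r * x))
        rw [AddChar.norm_apply] at this
        exact (abs_le.1 this).1
      nlinarith [hf0 r, sq_nonneg (f r), mul_nonneg (hf0 r) (sub_nonneg.2 hr'.le),
        mul_nonneg (sq_nonneg (f r)) (sub_nonneg.2 h5)]
    have h6 := Finset.sum_le_sum h4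
    rw [Finset.sum_neg_distrib, ← Finset.mul_sum] at h6
    have h7 : n ^ 2 ≤ ∑ r ∈ Γ, f r := by
      rw [← hfz]
      exact Finset.single_le_sum (fun r _ => hf0 r) h0Γ
    have h8 : ∑ r ∈ Γᶜ, f r ≤ m * n - n ^ 2 := by
      have := hsplit f
      linarith
    have h9 : n ^ 3 / m * ∑ r ∈ Γᶜ, f r ≤ n ^ 3 / m * (m * n - n ^ 2) := by gcongr
    have h10 : n ^ 3 / m * (m * n - n ^ 2) = n ^ 4 - n ^ 5 / m := by field_simp
    have h11 : 0 < n ^ 5 / m := by positivity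
    linarith

end Bogolyubov

/-- The lattice of integer vectors congruent modulo `m` to a multiple of the vector of the elements
of `insert 1 Γ`. -/
def bohrLattice {m : ℕ} (Γ : Finset (ZMod m)) :
    Submodule ℤ ({r // r ∈ insert 1 Γ} → ℤ) where
  carrier := {z | ∀ i, (z i : ZMod m) = i * (z ⟨1, Finset.mem_insert_self 1 Γ⟩ : ℤ)}
  add_mem' {a b} ha hb i := by
    simp only [Pi.add_apply, Int.cast_add, mul_add]
    rw [ha i, hb i]
  zero_mem' i := by simp
  smul_mem' c x hx i := by
    simp only [Pi.smul_apply, smul_eq_mul, Int.cast_mul]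
    rw [hx i]
    ring

lemma re_stdAddChar_nonneg {m : ℕ} [NeZero m] {z : ℤ} (hz : |(z : ℝ)| ≤ m / 4) :
    0 ≤ (ZMod.stdAddChar (z : ZMod m)).re := by
  have hm : (0 : ℝ) < m := by exact_mod_cast Nat.pos_of_neZero m
  have h : (2 * Real.pi * Complex.I * z / m : ℂ) = ((2 * Real.pi * (z / m) : ℝ) : ℂ) * Complex.I := by
    push_cast
    ring
  rw [ZMod.stdAddChar_coe, h, Complex.exp_ofReal_mul_I_re]
  have h2 : |(z / m : ℝ)| ≤ 1 / 4 := by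
    rw [abs_div, abs_of_pos hm, div_le_iff₀ hm]
    linarith
  rw [abs_le] at h2
  exact Real.cos_nonneg_of_mem_Icc ⟨by nlinarith [Real.pi_pos], by nlinarith [Real.pi_pos]⟩

lemma abs_sub_mul_lt_of_div_eq {a b Q m : ℕ} (hm : 0 < m) (h : a * Q / m = b * Q / m) :
    |(a : ℤ) - b| * Q < m := by
  have h1 := Nat.div_add_mod (a * Q) m
  have h2 := Nat.div_add_mod (b * Q) m
  have h3 := Nat.mod_lt (a * Q) hm
  have h4 := Nat.mod_lt (b * Q) hm
  rw [h] at h1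
  have h5 : ((a : ℤ) - b) * Q = (a * Q % m : ℕ) - (b * Q % m : ℕ) := by
    have h1' : (m : ℤ) * (b * Q / m : ℕ) + (a * Q % m : ℕ) = a * Q := by exact_mod_cast h1
    have h2' : (m : ℤ) * (b * Q / m : ℕ) + (b * Q % m : ℕ) = b * Q := by exact_mod_cast h2
    linarith
  rw [← Nat.abs_cast Q, ← abs_mul, h5, abs_lt]
  omega

/-- Bohr sets contain large proper progressions. -/
theorem exists_progression_in_bohr {m : ℕ} [NeZero m] (Γ : Finset (ZMod m)) :
    ∃ k ≤ Γ.card + 1, ∃ (L : Fin k → ℕ) (η : (Fin k → ℤ) →+ ZMod m),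
      (∀ n ∈ intBox L, ∀ r ∈ Γ, 0 ≤ (ZMod.stdAddChar (r * η n)).re) ∧
      (∀ n ∈ intBox L, ∀ n' ∈ intBox L, η n = η n' → n = n') ∧
      m ≤ (4 * (Γ.card + 2) * (reducedConst (Γ.card + 1) + 1)) ^ (Γ.card + 1) *
        ∏ i, (2 * L i + 1) := by
  classical
  have hm0 : 0 < m := Nat.pos_of_neZero m
  have hm : (0 : ℝ) < m := by exact_mod_cast hm0
  have hg : (0 : ℝ) < 4 * (Γ.card + 2) := by positivity
  set Q := 4 * (Γ.card + 2) * (reducedConst (Γ.card + 1) + 1) with hQ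
  have hQ0 : 0 < Q := by positivity
  have hQR : (0 : ℝ) < Q := by exact_mod_cast hQ0
  have hmQ : (reducedConst (Γ.card + 1) + 1) * ((m : ℝ) / Q) = m / (4 * (Γ.card + 2)) := by
    rw [hQ]
    push_cast
    field_simp
  set ι := {r // r ∈ insert 1 Γ}
  set i₁ : ι := ⟨1, Finset.mem_insert_self 1 Γ⟩
  have hι : Fintype.card ι ≤ Γ.card + 1 := by
    rw [Fintype.card_coe]
    exact Finset.card_insert_le _ _
  set Λ := bohrLattice Γ
  have hΛ : ∀ z : Λ, ∀ i : ι, ((z : ι → ℤ) i : ZMod m) = i * ((z : ι → ℤ) i₁ : ℤ) :=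
    fun z => z.2
  set N : Λ → ℝ := fun z => weightedNorm (fun _ => 1) (z : ι → ℤ) with hNdef
  have hN : IsLatticeNorm N := (isLatticeNorm_weightedNorm fun _ => one_pos).comap
    Λ.subtype.toAddMonoidHom Subtype.val_injective
  have hNle : ∀ (z : Λ) {R : ℝ}, 0 ≤ R → (N z ≤ R ↔ ∀ i, |((z : ι → ℤ) i : ℝ)| ≤ R) := by
    intro z R hR
    have := weightedNorm_le_iff (w := fun _ : ι => (1 : ℝ)) (fun _ => one_pos)
      (z := (z : ι → ℤ)) hR
    simp only [mul_one] at this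
    exact this
  obtain ⟨k, hk⟩ : ∃ k, Module.finrank ℤ Λ = k := ⟨_, rfl⟩
  have hkι : k ≤ Γ.card + 1 := by
    have := Submodule.finrank_le Λ
    rw [hk, Module.finrank_fintype_fun_eq_card] at this
    exact this.trans hι
  obtain ⟨b, hli, hspan⟩ := IsLatticeNorm.exists_reduced_basis k hN hk
  have hb0 : ∀ i, 0 < N (b i) := fun i => hN.pos _ fun hi => by
    have := congrFun (hli (Pi.single i 1) (by simp [Pi.single_apply, hi])) i
    simp at this
  set R : ℝ := m / (4 * (Γ.card + 2)) with hRdef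
  have hR0 : 0 ≤ R := div_nonneg hm.le hg.le
  set L : Fin k → ℕ := fun i => ⌊R / N (b i)⌋₊
  let ψ : (Fin k → ℤ) →+ Λ :=
    { toFun := fun n => ∑ i, n i • b i
      map_zero' := by simp
      map_add' := fun x y => by simp [add_smul, Finset.sum_add_distrib] }
  have hψ : ∀ n, ψ n = ∑ i, n i • b i := fun n => rfl
  let ev : Λ →+ ZMod m :=
    { toFun := fun z => (((z : ι → ℤ) i₁ : ℤ) : ZMod m)
      map_zero' := by simp
      map_add' := fun x y => by simp }
  have hev : ∀ z : Λ, ev z = (((z : ι → ℤ) i₁ : ℤ) : ZMod m) := fun z => rfl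
  have hNψ : ∀ n ∈ intBox L, ∀ i, |((ψ n : ι → ℤ) i : ℝ)| < m / 4 := by
    intro n hn i
    have h1 : N (ψ n) ≤ k * R := by
      rw [hψ]
      refine (hN.sum_le _ _).trans ?_
      have h2 : ∀ j ∈ Finset.univ, N (n j • b j) ≤ R := fun j _ => by
        rw [hN.zsmul]
        exact abs_mul_le_of_mem_intBox hR0 hb0 hn j
      refine (Finset.sum_le_card_nsmul _ _ _ h2).trans ?_
      simp
    refine ((hNle _ (mul_nonneg (Nat.cast_nonneg k) hR0)).1 h1 i).trans_lt ?_
    have hk' : (k : ℝ) ≤ Γ.card + 1 := by exact_mod_cast hkι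
    rw [hRdef, mul_div_assoc', div_lt_div_iff₀ hg four_pos]
    nlinarith
  refine ⟨k, hkι, L, ev.comp ψ, ?_, ?_, ?_⟩
  · intro n hn r hr
    have h1 := hΛ (ψ n) ⟨r, Finset.mem_insert_of_mem hr⟩
    rw [AddMonoidHom.comp_apply, hev, ← h1]
    exact re_stdAddChar_nonneg (hNψ n hn _).le
  · intro n hn n' hn' h
    rw [AddMonoidHom.comp_apply, AddMonoidHom.comp_apply, ← sub_eq_zero, ← map_sub] at h
    have h1 : ψ n - ψ n' = 0 := by
      refine Subtype.ext (funext fun i => ?_)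
      have h2 := hΛ (ψ n - ψ n') i
      rw [← hev, h, mul_zero, ZMod.intCast_zmod_eq_zero_iff_dvd] at h2
      refine Int.eq_zero_of_abs_lt_dvd h2 ?_
      have h3 := hNψ n hn i
      have h4 := hNψ n' hn' i
      have h5 : |(((ψ n - ψ n' : Λ) : ι → ℤ) i : ℝ)| < m := by
        have : (((ψ n - ψ n' : Λ) : ι → ℤ) i : ℝ) =
            ((ψ n : ι → ℤ) i : ℝ) - ((ψ n' : ι → ℤ) i : ℝ) := by simp
        rw [this]
        refine (abs_sub _ _).trans_lt ?_
        linarith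
      exact_mod_cast h5
    rw [← map_sub, hψ] at h1
    exact sub_eq_zero.1 (hli _ h1)
  · let zv : ZMod m → Λ := fun x => ⟨fun i => ((i.1 * x).val : ℤ), fun i => by simp⟩
    have hzv : ∀ x i, (zv x : ι → ℤ) i = ((i.1 * x).val : ℤ) := fun x i => rfl
    have hzvinj : Function.Injective zv := fun x y h => by
      have := congrArg ev h
      simpa [hev, hzv, i₁] using this
    let cell : ZMod m → ι → Fin Q := fun x i => ⟨(i.1 * x).val * Q / m,
      Nat.div_lt_of_lt_mul (Nat.mul_lt_mul_of_pos_right (ZMod.val_lt _) hQ0)⟩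
    have hcell : ∀ c ∈ (Finset.univ : Finset (ι → Fin Q)),
        (Finset.univ.filter fun x => cell x = c).card ≤ ∏ i, (2 * L i + 1) := by
      intro c _
      rcases (Finset.univ.filter fun x => cell x = c).eq_empty_or_nonempty with he | ⟨x₀, hx₀⟩
      · simp [he]
      choose coef hcoef hcoefle using fun x => hspan (zv x - zv x₀)
      rw [← card_intBox]
      refine Finset.card_le_card_of_injOn coef ?_ ?_
      · intro x hx
        have hxc : cell x = cell x₀ :=
          (Finset.mem_filter.1 hx).2.trans (Finset.mem_filter.1 hx₀).2.symm
        have h1 : N (zv x - zv x₀) ≤ m / Q := by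
          rw [hNle _ (div_nonneg hm.le hQR.le)]
          intro i
          have h2 : (i.1 * x).val * Q / m = (i.1 * x₀).val * Q / m :=
            congrArg Fin.val (congrFun hxc i)
          have h3 := abs_sub_mul_lt_of_div_eq hm0 h2
          rw [le_div_iff₀ hQR]
          have h4 : ((zv x - zv x₀ : Λ) : ι → ℤ) i = ((i.1 * x).val : ℤ) - (i.1 * x₀).val := rfl
          rw [h4]
          exact_mod_cast h3.le
        refine Finset.mem_coe.2 (mem_intBox_of_mul_le hb0 fun i => (hcoefle x i).trans ?_)
        have h5 : (reducedConst k : ℝ) ≤ reducedConst (Γ.card + 1) := by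
          exact_mod_cast reducedConst_mono hkι
        calc (reducedConst k : ℝ) * N (zv x - zv x₀)
            ≤ (reducedConst (Γ.card + 1) + 1) * (m / Q) := by
              refine mul_le_mul (by linarith) h1 (hN.nonneg _) (add_nonneg (Nat.cast_nonneg _) zero_le_one)
          _ = R := hmQ
      · intro x _ y _ h
        have : zv x - zv x₀ = zv y - zv x₀ := by rw [hcoef x, hcoef y, h]
        exact hzvinj (sub_left_injective this)
    have h1 := Finset.card_le_mul_card_image_of_maps_to (s := (Finset.univ : Finset (ZMod m)))
      (fun x _ => Finset.mem_univ (cell x)) _ hcell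
    rw [Finset.card_univ, ZMod.card, Finset.card_univ, Fintype.card_fun, Fintype.card_fin,
      mul_comm] at h1
    refine h1.trans ?_
    gcongr

lemma exists_dilation {p : ℕ} [Fact p.Prime] (T : Finset ℤ) (h0 : 0 ∈ T)
    (hT : ∀ s ∈ T, s.natAbs < p) :
    ∃ q : ZMod p, q ≠ 0 ∧ ∀ s ∈ T, s ≠ 0 → ¬ T.card ∣ (q * s : ZMod p).val := by
  classical
  have hp : 1 < p := (Fact.out : p.Prime).one_lt
  have hTpos : 0 < T.card := Finset.card_pos.2 ⟨0, h0⟩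
  set bad := (T.erase 0).biUnion fun s =>
    (Finset.univ.erase (0 : ZMod p)).filter fun q => T.card ∣ (q * s : ZMod p).val
  have hs0 : ∀ s ∈ T.erase 0, (s : ZMod p) ≠ 0 := by
    intro s hs h
    rw [ZMod.intCast_zmod_eq_zero_iff_dvd] at h
    obtain ⟨h1, h2⟩ := Finset.mem_erase.1 hs
    have h3 := Nat.le_of_dvd (Int.natAbs_pos.2 h1) (Int.natCast_dvd.1 h)
    have h4 := hT s h2
    omega
  have hbad : bad.card ≤ (T.erase 0).card * ((p - 1) / T.card) := by
    refine Finset.card_biUnion_le_card_mul _ _ _ fun s hs => ?_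
    rw [← Nat.Ioc_filter_dvd_card_eq_div]
    refine Finset.card_le_card_of_injOn (fun q => (q * s : ZMod p).val) ?_ ?_
    · intro q hq
      obtain ⟨h1, h2⟩ := Finset.mem_filter.1 hq
      have h3 : (q * s : ZMod p) ≠ 0 := mul_ne_zero (Finset.ne_of_mem_erase h1) (hs0 s hs)
      have h4 := ZMod.val_lt (q * s : ZMod p)
      have h5 := (ZMod.val_pos).2 h3
      exact Finset.mem_coe.2 (Finset.mem_filter.2
        ⟨Finset.mem_Ioc.2 ⟨h5, Nat.le_sub_one_of_lt h4⟩, h2⟩)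
    · intro q _ q' _ h
      exact mul_right_cancel₀ (hs0 s hs) (ZMod.val_injective p h)
  have hlt : bad.card < (Finset.univ.erase (0 : ZMod p)).card := by
    rw [Finset.card_erase_of_mem (Finset.mem_univ _), Finset.card_univ, ZMod.card]
    refine hbad.trans_lt ?_
    rw [Finset.card_erase_of_mem h0]
    rcases Nat.eq_zero_or_pos ((p - 1) / T.card) with h | h
    · rw [h]
      omega
    · calc (T.card - 1) * ((p - 1) / T.card) < T.card * ((p - 1) / T.card) :=
            Nat.mul_lt_mul_of_pos_right (by omega) h
        _ ≤ p - 1 := Nat.mul_div_le _ _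
  obtain ⟨q, hq, hqb⟩ := Finset.exists_mem_notMem_of_card_lt_card hlt
  refine ⟨q, Finset.ne_of_mem_erase hq, fun s hs hs0 hd => hqb ?_⟩
  exact Finset.mem_biUnion.2 ⟨s, Finset.mem_erase.2 ⟨hs0, hs⟩, Finset.mem_filter.2 ⟨hq, hd⟩⟩

lemma neg_mem_nsmul_sub_nsmul {A : Finset ℤ} {n : ℕ} {s : ℤ} (hs : s ∈ n • A - n • A) :
    -s ∈ n • A - n • A := by
  obtain ⟨a, ha, b, hb, rfl⟩ := Finset.mem_sub.1 hs
  rw [neg_sub]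
  exact Finset.sub_mem_sub hb ha

/-- Ruzsa's model lemma: a large piece of `A` is isomorphic to a dense set of residues. The
isomorphism is given by its graph `G`. -/
theorem exists_model (A : Finset ℤ) (hA : A.Nonempty) :
    ∃ G : Finset (ℤ × ZMod (6 • A - 6 • A).card), (∀ g ∈ G, g.1 ∈ A) ∧ A.card ≤ 6 * G.card ∧
      ∀ g ∈ 6 • (G - G), g.1 = 0 ↔ g.2 = 0 := by
  classical
  set T := 6 • A - 6 • A with hT
  set m := T.card
  have h0 : 0 ∈ T := by
    obtain ⟨a, ha⟩ := hA.nsmul (n := 6)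
    rw [← sub_self a]
    exact Finset.sub_mem_sub ha ha
  obtain ⟨p, hpT, hp⟩ := Nat.exists_infinite_primes (T.sup Int.natAbs + 1)
  have : Fact p.Prime := ⟨hp⟩
  have hTp : ∀ s ∈ T, s.natAbs < p := fun s hs => by
    have := Finset.le_sup (f := Int.natAbs) hs
    omega
  obtain ⟨q, hq0, hq⟩ := exists_dilation T h0 hTp
  set r : ℤ → ℕ := fun a => (q * a : ZMod p).val
  have hr : ∀ a, r a < p := fun a => ZMod.val_lt _
  have hmaps : ∀ a ∈ A, r a * 6 / p ∈ Finset.range 6 := fun a _ => by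
    rw [Finset.mem_range]
    exact Nat.div_lt_of_lt_mul (Nat.mul_lt_mul_of_pos_right (hr a) (by norm_num))
  obtain ⟨c, -, hc⟩ := Finset.exists_le_card_fiber_of_nsmul_le_card_of_maps_to
    (s := A) (t := Finset.range 6) (b := (A.card : ℚ) / 6) (f := fun a => r a * 6 / p) hmaps
    ⟨0, by simp⟩ (by simp only [Finset.card_range, nsmul_eq_mul]; push_cast; linarith)
  set B := A.filter fun a => r a * 6 / p = c
  have hrq : ∀ a : ℤ, ((r a : ℕ) : ZMod p) = q * a := fun a => ZMod.natCast_zmod_val _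
  set G : Finset (ℤ × ZMod m) := B.image fun a => (a, (r a : ZMod m)) with hG
  have hGcard : G.card = B.card := Finset.card_image_of_injective _ fun a b h => (Prod.ext_iff.1 h).1
  have hkey : ∀ n : ℕ, ∀ g ∈ n • (G - G), g.1 ∈ n • (A - A) ∧
      ∃ y : ℤ, g.2 = (y : ZMod m) ∧ (y : ZMod p) = q * g.1 ∧ 6 * |y| ≤ n * (p - 1) := by
    intro n
    induction n with
    | zero =>
      intro g hg
      rw [zero_nsmul, Finset.mem_zero] at hg
      subst hg
      exact ⟨by simp, 0, by simp, by simp, by simp⟩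
    | succ n ih =>
      intro g hg
      rw [succ_nsmul] at hg
      obtain ⟨g₁, hg₁, g₂, hg₂, rfl⟩ := Finset.mem_add.1 hg
      obtain ⟨u, hu, v, hv, rfl⟩ := Finset.mem_sub.1 hg₂
      obtain ⟨a, ha, rfl⟩ := Finset.mem_image.1 hu
      obtain ⟨b, hb, rfl⟩ := Finset.mem_image.1 hv
      obtain ⟨haA, hac⟩ := Finset.mem_filter.1 ha
      obtain ⟨hbA, hbc⟩ := Finset.mem_filter.1 hb
      obtain ⟨h1, y, h2, h3, h4⟩ := ih g₁ hg₁
      refine ⟨?_, y + ((r a : ℤ) - r b), ?_, ?_, ?_⟩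
      · rw [succ_nsmul]
        exact Finset.add_mem_add h1 (Finset.sub_mem_sub haA hbA)
      · simp [h2]
      · push_cast
        rw [h3, hrq, hrq]
        simp only [Prod.fst_add, Prod.fst_sub]
        push_cast
        ring
      · have h5 := abs_sub_mul_lt_of_div_eq hp.pos (hac.trans hbc.symm)
        have h6 := abs_add_le y ((r a : ℤ) - r b)
        push_cast at h5 ⊢
        linarith
  refine ⟨G, ?_, ?_, ?_⟩
  · intro g hg
    obtain ⟨a, ha, rfl⟩ := Finset.mem_image.1 hg
    exact (Finset.mem_filter.1 ha).1
  · rw [hGcard]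
    rw [div_le_iff₀ (by norm_num)] at hc
    rw [mul_comm]
    exact_mod_cast hc
  · intro g hg
    obtain ⟨h1, y, h2, h3, h4⟩ := hkey 6 g hg
    rw [nsmul_sub] at h1
    have hyp : |y| < p := by push_cast at h4; linarith
    have hpos : ∀ s ∈ T, s ≠ 0 → ∀ y : ℤ, 0 < y → y < p → (y : ZMod p) = q * s →
        ¬ (m : ℤ) ∣ y := by
      intro s hs hs0 y hy hyp hyq hdvd
      refine hq s hs hs0 ?_
      lift y to ℕ using hy.le
      rw [← hyq, Int.cast_natCast, ZMod.val_natCast_of_lt (by exact_mod_cast hyp)]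
      exact_mod_cast hdvd
    rw [abs_lt] at hyp
    constructor
    · intro h
      rw [h, Int.cast_zero, mul_zero, ZMod.intCast_zmod_eq_zero_iff_dvd] at h3
      rw [h2, Int.eq_zero_of_abs_lt_dvd h3 (abs_lt.2 hyp), Int.cast_zero]
    · intro h
      by_contra hs
      rw [h2, ZMod.intCast_zmod_eq_zero_iff_dvd] at h
      rcases lt_trichotomy y 0 with hy | hy | hy
      · exact hpos (-g.1) (neg_mem_nsmul_sub_nsmul h1) (neg_ne_zero.2 hs) (-y) (by omega) (by omega)
          (by push_cast; rw [h3]; ring) ((dvd_neg).2 h)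
      · rw [hy, Int.cast_zero, eq_comm] at h3
        have h5 := (mul_eq_zero.1 h3).resolve_left hq0
        rw [ZMod.intCast_zmod_eq_zero_iff_dvd] at h5
        have h6 := hTp g.1 h1
        exact hs (Int.eq_zero_of_abs_lt_dvd h5 (by rw [Int.abs_eq_natAbs]; exact_mod_cast h6))
      · exact hpos g.1 h1 hs y hy (by omega) h3 h

/-- A map on a box that is the shadow of a homomorphism under a partial isomorphism, given by its
graph `W`, lifts to a homomorphism. -/
lemma exists_lift_of_intBox {R : Type*} [AddCommGroup R] (W : Set (ℤ × R)) (h0 : 0 ∈ W)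
    (hneg : ∀ w ∈ W, -w ∈ W)
    (hinj : ∀ u ∈ W, ∀ v ∈ W, ∀ w ∈ W, (u + v + w).2 = 0 → (u + v + w).1 = 0)
    {k : ℕ} (L : Fin k → ℕ) (η : (Fin k → ℤ) →+ R)
    (hη : ∀ n ∈ intBox L, ∃ x : ℤ, (x, η n) ∈ W) :
    ∃ φ : (Fin k → ℤ) →+ ℤ, ∀ n ∈ intBox L, (φ n, η n) ∈ W := by
  classical
  have hgen : ∀ i : Fin k, ∃ x : ℤ, 1 ≤ L i → (x, η (Pi.single i 1)) ∈ W := by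
    intro i
    by_cases hi : 1 ≤ L i
    · have hmem : Pi.single i 1 ∈ intBox L := by
        rw [mem_intBox]
        intro j
        by_cases hj : j = i
        · subst hj
          simpa using hi
        · simp [Pi.single_eq_of_ne hj]
      obtain ⟨x, hx⟩ := hη _ hmem
      exact ⟨x, fun _ => hx⟩
    · exact ⟨0, fun h => absurd h hi⟩
  choose a ha using hgen
  set φ : (Fin k → ℤ) →+ ℤ :=
    { toFun := fun n => ∑ i, n i * a i
      map_zero' := by simp
      map_add' := fun x y => by simp [add_mul, Finset.sum_add_distrib] } with hφ
  have hφs : ∀ i (ε : ℤ), φ (Pi.single i ε) = ε * a i := by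
    intro i ε
    change ∑ j, (Pi.single i ε : Fin k → ℤ) j * a j = ε * a i
    rw [Finset.sum_eq_single i]
    · simp
    · intro j _ hj
      simp [Pi.single_eq_of_ne hj]
    · simp
  have hstep : ∀ N : ℕ, ∀ n ∈ intBox L, ∑ i, (n i).natAbs = N → (φ n, η n) ∈ W := by
    intro N
    induction N with
    | zero =>
      intro n _ hN
      have hn : n = 0 := by
        funext i
        have := (Finset.sum_eq_zero_iff.1 hN) i (Finset.mem_univ i)
        simpa using this
      rw [hn, map_zero, map_zero]
      exact h0
    | succ N ih =>
      intro n hn hN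
      obtain ⟨i, -, hi⟩ := Finset.exists_ne_zero_of_sum_ne_zero (by omega : ∑ i, (n i).natAbs ≠ 0)
      have hni : n i ≠ 0 := by simpa using hi
      have hLi := (mem_intBox.1 hn) i
      have hLpos : 1 ≤ L i := by
        have := abs_pos.2 hni
        omega
      obtain ⟨ε, hε, hlt⟩ : ∃ ε : ℤ, (ε = 1 ∨ ε = -1) ∧ (n i - ε).natAbs + 1 = (n i).natAbs := by
        rcases lt_or_gt_of_ne hni with h | h
        · exact ⟨-1, Or.inr rfl, by omega⟩
        · exact ⟨1, Or.inl rfl, by omega⟩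
      have hsingle : (φ (Pi.single i ε), η (Pi.single i ε)) ∈ W := by
        rw [hφs]
        rcases hε with rfl | rfl
        · simpa using ha i hLpos
        · have := hneg _ (ha i hLpos)
          simpa [Pi.single_neg] using this
      set n' := n - Pi.single i ε with hn'
      have hn'i : n' i = n i - ε := by simp [hn']
      have hn'j : ∀ j, j ≠ i → n' j = n j := fun j hj => by simp [hn', Pi.single_eq_of_ne hj]
      have hbox : n' ∈ intBox L := by
        rw [mem_intBox]
        intro j
        by_cases hj : j = i
        · subst hj
          rw [hn'i, Int.abs_eq_natAbs]
          rw [Int.abs_eq_natAbs] at hLi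
          omega
        · rw [hn'j j hj]
          exact (mem_intBox.1 hn) j
      have hsum : ∑ j, (n' j).natAbs = N := by
        rw [← Finset.add_sum_erase _ _ (Finset.mem_univ i)] at hN ⊢
        rw [Finset.sum_congr rfl fun j hj => by rw [hn'j j (Finset.ne_of_mem_erase hj)], hn'i]
        omega
      have hn'W := ih n' hbox hsum
      obtain ⟨x, hx⟩ := hη n hn
      have hsplit : n = n' + Pi.single i ε := by rw [hn', sub_add_cancel]
      have h := hinj _ hx _ (hneg _ hn'W) _ (hneg _ hsingle) (by
        have : η n = η n' + η (Pi.single i ε) := by rw [← map_add, ← hsplit]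
        simp [this])
      have hxφ : x = φ n := by
        have : φ n = φ n' + φ (Pi.single i ε) := by rw [← map_add, ← hsplit]
        rw [this]
        simp only [Prod.fst_add, Prod.fst_neg] at h
        linarith
      rwa [← hxφ]
  exact ⟨φ, fun n hn => hstep _ n hn rfl⟩

lemma card_nsmul_sub_nsmul_le {K : ℕ} {A : Finset ℤ} (hA : A.Nonempty)
    (hK : (A + A).card ≤ K * A.card) (m n : ℕ) :
    (m • A - n • A).card ≤ K ^ (m + n) * A.card := by
  have h := Finset.pluennecke_ruzsa_inequality_nsmul_sub_nsmul_add hA A m n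
  have hpos : (0 : ℚ≥0) < A.card := by exact_mod_cast hA.card_pos
  have hdiv : ((A + A).card / A.card : ℚ≥0) ≤ K := by
    rw [div_le_iff₀ hpos]
    exact_mod_cast hK
  have h2 : ((m • A - n • A).card : ℚ≥0) ≤ K ^ (m + n) * A.card := by
    refine h.trans ?_
    gcongr
  exact_mod_cast h2

lemma image_sub_finset {R S : Type*} [AddCommGroup R] [AddCommGroup S] [DecidableEq R]
    [DecidableEq S] (f : R →+ S) (s t : Finset R) :
    (s - t).image f = s.image f - t.image f :=
  Finset.image_image₂_distrib (map_sub f)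

theorem exists_proper_progression (K : ℕ) : ∃ D C : ℕ, ∀ A : Finset ℤ, A.Nonempty →
    (A + A).card ≤ K * A.card → ∃ k ≤ D, ∃ (L : Fin k → ℕ) (φ : (Fin k → ℤ) →+ ℤ),
      (∀ n ∈ intBox L, ∀ n' ∈ intBox L, φ n = φ n' → n = n') ∧
      (∀ n ∈ intBox L, φ n ∈ 2 • A - 2 • A) ∧ A.card ≤ C * ∏ i, (2 * L i + 1) := by
  classical
  set M := 36 * K ^ 24 with hM
  refine ⟨M + 1, 6 * (4 * (M + 2) * (reducedConst (M + 1) + 1)) ^ (M + 1), fun A hA hK => ?_⟩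
  obtain ⟨m, hm, G, hGA, hGcard, hGiso⟩ : ∃ m, m = (6 • A - 6 • A).card ∧
      ∃ G : Finset (ℤ × ZMod m), (∀ g ∈ G, g.1 ∈ A) ∧ A.card ≤ 6 * G.card ∧
        ∀ g ∈ 6 • (G - G), g.1 = 0 ↔ g.2 = 0 := ⟨_, rfl, exists_model A hA⟩
  have hmpos : 0 < m := by
    rw [hm, Finset.card_pos]
    exact hA.nsmul.sub hA.nsmul
  have : NeZero m := ⟨hmpos.ne'⟩
  have hmK : m ≤ K ^ 12 * A.card := hm ▸ card_nsmul_sub_nsmul_le hA hK 6 6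
  have hApos := hA.card_pos
  have hGne : G.Nonempty := Finset.card_pos.1 (by omega)
  have h0 : (0 : ℤ × ZMod m) ∈ G - G := by
    obtain ⟨g, hg⟩ := hGne
    exact Finset.mem_sub.2 ⟨g, hg, g, hg, sub_self g⟩
  have hmono : ∀ {i : ℕ}, i ≤ 6 → i • (G - G) ⊆ 6 • (G - G) := fun hi =>
    Finset.nsmul_subset_nsmul_right h0 hi
  set S := G.image Prod.snd with hS
  have hScard : S.card = G.card := by
    refine Finset.card_image_of_injOn fun g hg g' hg' h => ?_
    have hmem : g - g' ∈ 6 • (G - G) := hmono (by norm_num : 1 ≤ 6) (by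
      rw [one_nsmul]
      exact Finset.sub_mem_sub hg hg')
    have h1 := (hGiso _ hmem).2 (sub_eq_zero.2 h)
    exact Prod.ext (sub_eq_zero.1 h1) h
  have hSm : S.card ≤ m := by
    simpa [ZMod.card] using Finset.card_le_univ S
  obtain ⟨Γ, hΓcard, hΓ⟩ := exists_bohr_subset S (hGne.image _)
  have hΓM : Γ.card ≤ M := by
    have hSpos : 0 < S.card ^ 2 := by
      rw [hScard]
      exact pow_pos hGne.card_pos 2
    refine Nat.le_of_mul_le_mul_right (hΓcard.trans ?_) hSpos
    calc m ^ 2 ≤ (K ^ 12 * (6 * S.card)) ^ 2 := by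
          rw [hScard]
          exact Nat.pow_le_pow_left (hmK.trans (Nat.mul_le_mul_left _ hGcard)) 2
      _ = M * S.card ^ 2 := by rw [hM]; ring
  obtain ⟨k, hk, L, η, hL, hηinj, hsize⟩ := exists_progression_in_bohr Γ
  set W := 2 • (G - G) with hW
  have hWneg : ∀ w ∈ W, -w ∈ W := by
    intro w hw
    rw [hW, nsmul_sub] at hw ⊢
    obtain ⟨u, hu, v, hv, rfl⟩ := Finset.mem_sub.1 hw
    rw [neg_sub]
    exact Finset.sub_mem_sub hv hu
  have hWW : ∀ u ∈ W, ∀ v ∈ W, ∀ w ∈ W, u + v + w ∈ 6 • (G - G) := by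
    intro u hu v hv w hw
    have : 6 • (G - G) = W + W + W := by
      rw [hW, ← add_nsmul, ← add_nsmul]
    rw [this]
    exact Finset.add_mem_add (Finset.add_mem_add hu hv) hw
  have hW0 : (0 : ℤ × ZMod m) ∈ W := by
    rw [hW, two_nsmul, ← add_zero (0 : ℤ × ZMod m)]
    exact Finset.add_mem_add h0 h0
  have hsnd : W.image (AddMonoidHom.snd ℤ (ZMod m)) = 2 • (S - S) := by
    rw [hW, Finset.image_nsmul, image_sub_finset]
    rfl
  have hfst : W.image (AddMonoidHom.fst ℤ (ZMod m)) ⊆ 2 • A - 2 • A := by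
    rw [hW, Finset.image_nsmul, image_sub_finset, ← nsmul_sub]
    refine Finset.nsmul_subset_nsmul_left (Finset.sub_subset_sub ?_ ?_) <;>
    · intro x hx
      obtain ⟨g, hg, rfl⟩ := Finset.mem_image.1 hx
      exact hGA g hg
  obtain ⟨φ, hφ⟩ := exists_lift_of_intBox (W : Set (ℤ × ZMod m)) (by exact_mod_cast hW0)
    (by exact_mod_cast hWneg)
    (fun u hu v hv w hw => (hGiso _ (hWW u hu v hv w hw)).2) L η (fun n hn => by
      have h1 := hΓ (η n) (hL n hn)
      rw [← hsnd] at h1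
      obtain ⟨w, hw, hwn⟩ := Finset.mem_image.1 h1
      refine ⟨w.1, ?_⟩
      rw [← hwn]
      exact hw)
  refine ⟨k, by omega, L, φ, fun n hn n' hn' h => hηinj n hn n' hn' ?_, fun n hn => ?_, ?_⟩
  · have h1 := (hGiso _ (hWW _ (hφ n hn) _ (hWneg _ (hφ n' hn')) _ hW0)).1 (by simp [h])
    simpa [← sub_eq_add_neg, sub_eq_zero] using h1
  · exact hfst (Finset.mem_image.2 ⟨_, hφ n hn, rfl⟩)
  · calc A.card ≤ 6 * m := by omega
      _ ≤ 6 * ((4 * (Γ.card + 2) * (reducedConst (Γ.card + 1) + 1)) ^ (Γ.card + 1) *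
            ∏ i, (2 * L i + 1)) := by gcongr
      _ ≤ 6 * ((4 * (M + 2) * (reducedConst (M + 1) + 1)) ^ (M + 1) *
            ∏ i, (2 * L i + 1)) := by
        have hr : reducedConst (Γ.card + 1) ≤ reducedConst (M + 1) := reducedConst_mono (by omega)
        refine Nat.mul_le_mul_left _ (Nat.mul_le_mul_right _ ?_)
        refine (Nat.pow_le_pow_left (n := _) (m := 4 * (M + 2) * (reducedConst (M + 1) + 1)) ?_ _).trans
          (Nat.pow_le_pow_right (by positivity) (by omega))
        gcongr
      _ = _ := by ring

/-- Freiman's theorem in the integers. -/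
theorem exists_freiman_cover (K : ℕ) : ∃ D C : ℕ, ∀ A : Finset ℤ, A.Nonempty →
    (A + A).card ≤ K * A.card → ∃ k ≤ D, ∃ (φ : (Fin k → ℤ) →+ ℤ) (l : Fin k → ℕ),
      ∏ i, (2 * l i + 1) ≤ C * A.card ∧ ∀ x ∈ A, ∃ z ∈ intBox l, x = φ z := by
  classical
  obtain ⟨D, C, h⟩ := exists_proper_progression K
  set N := K ^ 5 * C with hN
  refine ⟨D + N, 2 ^ D * 3 ^ N * K ^ 4, fun A hA hK => ?_⟩
  obtain ⟨k, hk, L, φ, hinj, hsub, hcard⟩ := h A hA hK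
  set B := (intBox L).image φ with hB
  have hBcard : B.card = ∏ i, (2 * L i + 1) := by
    rw [hB, Finset.card_image_of_injOn fun n hn n' hn' hnn => hinj n hn n' hn' hnn, card_intBox]
  have hBne : B.Nonempty := ⟨φ 0, Finset.mem_image_of_mem _ (zero_mem_intBox L)⟩
  have hBA : B ⊆ 2 • A - 2 • A := by
    intro x hx
    obtain ⟨n, hn, rfl⟩ := Finset.mem_image.1 hx
    exact hsub n hn
  have hAB : (A + B).card ≤ N * B.card := by
    calc (A + B).card ≤ (3 • A - 2 • A).card := by
          refine Finset.card_le_card ((Finset.add_subset_add_left hBA).trans ?_)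
          rw [← add_sub_assoc, ← succ_nsmul']
      _ ≤ K ^ 5 * A.card := card_nsmul_sub_nsmul_le hA hK 3 2
      _ ≤ K ^ 5 * (C * B.card) := by
          rw [hBcard]
          gcongr
      _ = N * B.card := by rw [hN]; ring
  obtain ⟨F, -, hFN, hAF⟩ := Finset.ruzsa_covering_add (K := (N : ℝ)) hBne (by exact_mod_cast hAB)
  have hFN' : F.card ≤ N := by exact_mod_cast hFN
  set e := F.equivFin
  set ψ : (Fin (k + F.card) → ℤ) →+ ℤ :=
    { toFun := fun z => φ (fun i => z (Fin.castAdd _ i)) +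
        ∑ j : Fin F.card, z (Fin.natAdd k j) * (e.symm j : ℤ)
      map_zero' := by
        have : (fun _ : Fin k => (0 : ℤ)) = 0 := rfl
        simp [this]
      map_add' := fun x y => by
        have : (fun i : Fin k => (x + y) (Fin.castAdd F.card i)) =
          (fun i => x (Fin.castAdd F.card i)) + fun i => y (Fin.castAdd F.card i) := rfl
        rw [this, map_add]
        simp only [Pi.add_apply, add_mul, Finset.sum_add_distrib]
        ring } with hψ
  refine ⟨k + F.card, by omega, ψ, Fin.append (fun i => 2 * L i) (fun _ => 1), ?_, ?_⟩
  · have hbox : ∏ i, (2 * L i + 1) ≤ K ^ 4 * A.card := by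
      rw [← hBcard]
      exact (Finset.card_le_card hBA).trans (card_nsmul_sub_nsmul_le hA hK 2 2)
    rw [Fin.prod_univ_add]
    simp only [Fin.append_left, Fin.append_right, Finset.prod_const, Finset.card_univ,
      Fintype.card_fin]
    calc (∏ i, (2 * (2 * L i) + 1)) * (2 * 1 + 1) ^ F.card
        ≤ (∏ i, 2 * (2 * L i + 1)) * 3 ^ N := by
          refine Nat.mul_le_mul (Finset.prod_le_prod' fun i _ => by omega)
            (Nat.pow_le_pow_right (by norm_num) hFN')
      _ = 2 ^ k * (∏ i, (2 * L i + 1)) * 3 ^ N := by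
          rw [Finset.prod_mul_distrib]
          simp
      _ ≤ 2 ^ D * (K ^ 4 * A.card) * 3 ^ N := by
          gcongr
          norm_num
      _ = 2 ^ D * 3 ^ N * K ^ 4 * A.card := by ring
  · intro x hx
    obtain ⟨f, hf, y, hy, rfl⟩ := Finset.mem_add.1 (hAF hx)
    obtain ⟨b, hb, b', hb', rfl⟩ := Finset.mem_sub.1 hy
    obtain ⟨n, hn, rfl⟩ := Finset.mem_image.1 hb
    obtain ⟨n', hn', rfl⟩ := Finset.mem_image.1 hb'
    refine ⟨Fin.append (n - n') (Pi.single (e ⟨f, hf⟩) 1), ?_, ?_⟩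
    · rw [mem_intBox]
      intro i
      refine Fin.addCases (fun i => ?_) (fun j => ?_) i
      · simp only [Fin.append_left, Pi.sub_apply]
        have h1 := mem_intBox.1 hn i
        have h2 := mem_intBox.1 hn' i
        have h3 := abs_sub (n i) (n' i)
        push_cast
        linarith
      · simp only [Fin.append_right]
        by_cases hj : j = e ⟨f, hf⟩
        · simp [hj]
        · simp [Pi.single_eq_of_ne hj]
    · change _ = φ _ + ∑ j, _
      simp only [Fin.append_left, Fin.append_right]
      rw [Finset.sum_eq_single (e ⟨f, hf⟩)]
      · have : (fun i => (n - n') i) = n - n' := rfl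
        rw [this, map_sub]
        simp [add_comm]
      · intro j _ hj
        simp [Pi.single_eq_of_ne hj]
      · simp

theorem exists_structured_of_small_doubling (d : ℕ) : ∃ t : ℕ, ∀ A : Finset ℤ, A.Nonempty →
    (A + A).card < 2 ^ d * A.card → Structured d t A := by
  obtain ⟨D, C, h⟩ := exists_freiman_cover (2 ^ d)
  choose t ht using fun k : ℕ => exists_structured d k (k + 1) (max C 1)
  refine ⟨(Finset.range (D + 1)).sup t, fun A hA hAA => ?_⟩
  obtain ⟨k, hk, φ, l, hl, hcov⟩ := h A hA hAA.le
  refine Structured.mono (Finset.le_sup (Finset.mem_range.2 (by omega : k < D + 1)))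
    (ht k A hA hAA φ l Finset.univ (by simp) (by simp) (hl.trans ?_) hcov)
  gcongr
  exact le_max_left _ _

theorem stmt_3 :
    ∃ c : ℝ, 0 < c ∧ ∀ d : ℕ, 1 ≤ d → ∃ t : ℕ,
      ∀ A : Set ℤ, A.Finite → A.Nonempty →
        2 ^ (d - 1) * A.ncard ≤ (A + A).ncard → (A + A).ncard < 2 ^ d * A.ncard →
        ∀ d' : ℕ, d' < d → NonDegenerate d t A →
        ∃ X P : Set ℤ, X.Finite ∧
          (X.ncard : ℝ) ≤ d * Real.exp (Real.exp (c * d')) ∧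
          IsGAP d P ∧ P.ncard ≤ t * A.ncard ∧ A ⊆ X + P := by
  classical
  refine ⟨1, one_pos, fun d hd => ?_⟩
  obtain ⟨t, ht⟩ := exists_structured_of_small_doubling d
  refine ⟨t, fun A hAf hA _ hAA d' _ hnd => ?_⟩
  lift A to Finset ℤ using hAf
  rw [← Finset.coe_add, ncard_coe_finset, ncard_coe_finset] at hAA
  rcases ht A (by exact_mod_cast hA) hAA with
    ⟨X, P, hX, hXt, hP, hcov, hcard⟩ | ⟨x, P, hP, hcard, hcov⟩
  · exact absurd ⟨X, P, hX, hXt, hP, hcov, by rwa [ncard_coe_finset]⟩ hnd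
  · refine ⟨{x}, P, finite_singleton x, ?_, hP, by rwa [ncard_coe_finset], hcov⟩
    rw [ncard_singleton, Nat.cast_one]
    have h1 : (1 : ℝ) ≤ d := by exact_mod_cast hd
    have h2 : 1 ≤ Real.exp (Real.exp (1 * d')) := Real.one_le_exp (Real.exp_pos _).le
    nlinarith
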